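/- Let T be a complete first-order theory with infinite models in a countable language L, let M be an ℵ₁-saturated model of T, let p ∈ S₁(T), and suppose there is a relatively ∅-definable binary relation on p(M) (i.e., equal to p(M)² ∩ φ(M²) for some L-formula φ(x,y)) which is a discrete linear order on the infinite set p(M). Then T has exactly 2^ℵ₀ countably infinite models up to isomorphism. -/

import Mathlib

open FirstOrder FirstOrder.Language Set Cardinal

universe u v w

namespace PaperDef

variable {L : FirstOrder.Language.{u, v}}

/-- Valuation assigning parameters from `A` their own values and the
`n` free variables the values given by the tuple `x`. -/
def pval {M : Type w} {A : Set M} {n : ℕ} (x : Fin n → M) : ↥A ⊕ Fin n → M :=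
  Sum.elim Subtype.val x

variable {M : Type w} [L.Structure M]

/-- The subset of `M` defined by an `L(A)`-formula in one free variable. -/
def defSet (A : Set M) (δ : L.Formula (↥A ⊕ Fin 1)) : Set M :=
  {a | δ.Realize (pval ![a])}

/-- The binary relation on `M` defined by an `L(A)`-formula in two free variables. -/
def defRel (A : Set M) (φ : L.Formula (↥A ⊕ Fin 2)) : M → M → Prop :=
  fun a b => φ.Realize (pval ![a, b])

/-- The relation defined by `φ`, guarded so as to only hold on the set defined by `δ`
(the paper's convention of writing `x < y` for `x ∈ D ∧ y ∈ D ∧ x < y`). -/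
def gRel (A : Set M) (δ : L.Formula (↥A ⊕ Fin 1)) (φ : L.Formula (↥A ⊕ Fin 2)) :
    M → M → Prop :=
  fun a b => a ∈ defSet A δ ∧ b ∈ defSet A δ ∧ defRel A φ a b

/-- The set of realizations in `M` of a set of `L(A)`-formulas in one free variable. -/
def typeSet (A : Set M) (p : Set (L.Formula (↥A ⊕ Fin 1))) : Set M :=
  {a | ∀ φ ∈ p, φ.Realize (pval ![a])}

/-- A set of `L(A)`-formulas in `n` free variables is finitely satisfiable in `M`. -/
def FinSat (A : Set M) {n : ℕ} (p : Set (L.Formula (↥A ⊕ Fin n))) : Prop :=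
  ∀ s : Finset (L.Formula (↥A ⊕ Fin n)), ↑s ⊆ p →
    ∃ x : Fin n → M, ∀ φ ∈ s, Formula.Realize φ (pval x)

/-- A complete `n`-type over `A` (relative to the complete theory of `M` with
parameters in `A`): a maximal finitely satisfiable set of formulas. -/
def IsCompleteType (A : Set M) {n : ℕ} (p : Set (L.Formula (↥A ⊕ Fin n))) : Prop :=
  FinSat A p ∧ ∀ φ : L.Formula (↥A ⊕ Fin n), φ ∈ p ∨ BoundedFormula.not φ ∈ p

/-- `M` is ℵ₀-saturated: every finitely satisfiable set of formulas in one free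
variable with parameters from a finite subset of `M` is realized in `M`. -/
def IsAleph0Saturated (L : FirstOrder.Language.{u, v}) (M : Type w) [L.Structure M] : Prop :=
  ∀ A : Set M, A.Finite → ∀ p : Set (L.Formula (↥A ⊕ Fin 1)),
    FinSat A p → (typeSet A p).Nonempty

/-- `M` is ℵ₁-saturated: every finitely satisfiable set of formulas in one free
variable with parameters from a countable subset of `M` is realized in `M`. -/
def IsAleph1Saturated (L : FirstOrder.Language.{u, v}) (M : Type w) [L.Structure M] : Prop :=
  ∀ A : Set M, A.Countable → ∀ p : Set (L.Formula (↥A ⊕ Fin 1)),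
    FinSat A p → (typeSet A p).Nonempty

/-- The definable closure of `A` in `M`. -/
def dclSet (L : FirstOrder.Language.{u, v}) {M : Type w} [L.Structure M] (A : Set M) : Set M :=
  {a | ∃ φ : L.Formula (↥A ⊕ Fin 1),
    φ.Realize (pval ![a]) ∧ ∀ b : M, φ.Realize (pval ![b]) → b = a}

/-- `r` is a (strict) linear order on the set `D`. -/
def IsLinearOn {X : Type*} (r : X → X → Prop) (D : Set X) : Prop :=
  (∀ a ∈ D, ¬r a a) ∧
  (∀ a ∈ D, ∀ b ∈ D, ∀ c ∈ D, r a b → r b c → r a c) ∧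
  (∀ a ∈ D, ∀ b ∈ D, a = b ∨ r a b ∨ r b a)

/-- The linear order `r` on `D` is discrete: every element other than the maximum
has an immediate successor and every element other than the minimum has an
immediate predecessor. -/
def IsDiscreteOn {X : Type*} (r : X → X → Prop) (D : Set X) : Prop :=
  (∀ a ∈ D, (∃ b ∈ D, r a b) → ∃ b ∈ D, r a b ∧ ∀ c ∈ D, r a c → c = b ∨ r b c) ∧
  (∀ a ∈ D, (∃ b ∈ D, r b a) → ∃ b ∈ D, r b a ∧ ∀ c ∈ D, r c a → c = b ∨ r c b)

/-- `C` is an initial part of the order `(D, r)`. -/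
def IsInitialPart {X : Type*} (r : X → X → Prop) (D C : Set X) : Prop :=
  C ⊆ D ∧ ∀ c ∈ C, ∀ d ∈ D, r d c → d ∈ C

/-- `(C, r)` has order type ω: `C` is infinite and every element has only
finitely many predecessors in `C`. -/
def HasOrderTypeOmega {X : Type*} (r : X → X → Prop) (C : Set X) : Prop :=
  C.Infinite ∧ ∀ c ∈ C, {c' ∈ C | r c' c}.Finite

/-- `p` is a simple type over `A`, witnessed by `C ⊆ dcl(A)` and the `A`-definable
linear order `(D, <)` given by the formulas `δ` (defining `D`) and `lt` (defining `<`). -/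
def IsSimpleWitness (A : Set M) (p : Set (L.Formula (↥A ⊕ Fin 1))) (C : Set M)
    (δ : L.Formula (↥A ⊕ Fin 1)) (lt : L.Formula (↥A ⊕ Fin 2)) : Prop :=
  IsCompleteType A p ∧
  C.Infinite ∧
  C ⊆ dclSet L A ∧
  IsLinearOn (gRel A δ lt) (defSet A δ) ∧
  IsInitialPart (gRel A δ lt) (defSet A δ) C ∧
  HasOrderTypeOmega (gRel A δ lt) C ∧
  ∀ φ : L.Formula (↥A ⊕ Fin 1),
    φ ∈ p ↔ {c ∈ C | ¬φ.Realize (pval ![c])}.Finite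

/-- `b` is the immediate successor of `a` in the order `(P, r)`. -/
def SuccIn {X : Type*} (r : X → X → Prop) (P : Set X) (a b : X) : Prop :=
  a ∈ P ∧ b ∈ P ∧ r a b ∧ ∀ c ∈ P, r a c → c = b ∨ r b c

/-- `zIter S k a b` says that `b = Sᵏ(a)`, where negative iterates of `S` are
interpreted via the (partial) inverse of `S`. -/
def zIter {X : Type*} (S : X → X) (k : ℤ) (a b : X) : Prop :=
  if 0 ≤ k then S^[k.toNat] a = b else S^[(-k).toNat] b = a

/-- Isomorphism as an equivalence relation on countably infinite models of `T`
(with underlying set in `Type 0`). -/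
def countableModelSetoid (T : L.Theory) :
    Setoid {N : Theory.ModelType.{u, v, 0} T // Countable N ∧ Infinite N} where
  r N₁ N₂ := Nonempty (N₁.1 ≃[L] N₂.1)
  iseqv := ⟨fun N => ⟨FirstOrder.Language.Equiv.refl L N.1⟩,
    fun e => e.map FirstOrder.Language.Equiv.symm,
    fun e f => Nonempty.map2 (fun i j => j.comp i) e f⟩

/-- The number of countably infinite models of `T` up to isomorphism. -/
noncomputable def numCountableModels (T : L.Theory) : Cardinal :=
  #(Quotient (countableModelSetoid T))

end PaperDef

namespace DiscMod

/-- A relation on tuples indexed by `α` is definable by an `L`-formula without parameters. -/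
def Dfn (L : FirstOrder.Language.{u, v}) {M : Type w} [L.Structure M] {α : Type*}
    (R : (α → M) → Prop) : Prop := ∃ φ : L.Formula α, ∀ x, φ.Realize x ↔ R x

section dfn
variable {L : FirstOrder.Language.{u, v}} {M : Type w} [L.Structure M]

theorem Dfn.of {α : Type*} (φ : L.Formula α) : Dfn L (fun x : α → M => φ.Realize x) :=
  ⟨φ, fun _ => Iff.rfl⟩

theorem Dfn.congr {α : Type*} {R S : (α → M) → Prop} (h : Dfn L R) (e : ∀ x, R x ↔ S x) :
    Dfn L S := by
  obtain ⟨φ, hφ⟩ := h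
  exact ⟨φ, fun x => (hφ x).trans (e x)⟩

theorem Dfn.not {α : Type*} {R : (α → M) → Prop} (h : Dfn L R) : Dfn L (fun x => ¬ R x) := by
  obtain ⟨φ, hφ⟩ := h
  exact ⟨φ.not, fun x => by rw [Formula.realize_not, hφ]⟩

theorem Dfn.and {α : Type*} {R S : (α → M) → Prop} (h : Dfn L R) (h' : Dfn L S) :
    Dfn L (fun x => R x ∧ S x) := by
  obtain ⟨φ, hφ⟩ := h
  obtain ⟨ψ, hψ⟩ := h'
  exact ⟨φ ⊓ ψ, fun x => by rw [Formula.realize_inf, hφ, hψ]⟩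

theorem Dfn.or {α : Type*} {R S : (α → M) → Prop} (h : Dfn L R) (h' : Dfn L S) :
    Dfn L (fun x => R x ∨ S x) := by
  obtain ⟨φ, hφ⟩ := h
  obtain ⟨ψ, hψ⟩ := h'
  exact ⟨φ ⊔ ψ, fun x => by rw [Formula.realize_sup, hφ, hψ]⟩

theorem Dfn.imp {α : Type*} {R S : (α → M) → Prop} (h : Dfn L R) (h' : Dfn L S) :
    Dfn L (fun x => R x → S x) := by
  obtain ⟨φ, hφ⟩ := h
  obtain ⟨ψ, hψ⟩ := h'
  exact ⟨φ.imp ψ, fun x => by rw [Formula.realize_imp, hφ, hψ]⟩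

theorem Dfn.iff {α : Type*} {R S : (α → M) → Prop} (h : Dfn L R) (h' : Dfn L S) :
    Dfn L (fun x => R x ↔ S x) := by
  obtain ⟨φ, hφ⟩ := h
  obtain ⟨ψ, hψ⟩ := h'
  exact ⟨φ.iff ψ, fun x => by rw [Formula.realize_iff, hφ, hψ]⟩

theorem Dfn.const {α : Type*} (P : Prop) : Dfn L (fun _ : α → M => P) := by
  by_cases h : P
  · exact ⟨⊤, fun x => by simp [h]⟩
  · exact ⟨⊥, fun x => by simp [h]⟩

theorem Dfn.eq {α : Type*} (i j : α) : Dfn L (fun x : α → M => x i = x j) :=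
  ⟨Term.equal (Term.var i) (Term.var j), fun x => by simp [Formula.realize_equal]⟩

theorem Dfn.sub {α β : Type*} {R : (α → M) → Prop} (h : Dfn L R) (g : α → β) :
    Dfn L (fun x : β → M => R (fun i => x (g i))) := by
  obtain ⟨φ, hφ⟩ := h
  exact ⟨φ.relabel g, fun x => by rw [Formula.realize_relabel, hφ]; rfl⟩

/-- a formula depends only on finitely many variables -/
theorem Dfn.finsupp {α : Type*} {R : (α → M) → Prop} (h : Dfn L R) :
    ∃ F : Finset α, ∀ x y : α → M, (∀ i ∈ F, x i = y i) → (R x ↔ R y) := by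
  classical
  obtain ⟨φ, hφ⟩ := h
  refine ⟨BoundedFormula.freeVarFinset φ, fun x y hxy => ?_⟩
  rw [← hφ, ← hφ]
  have h1 := BoundedFormula.realize_restrictFreeVar (φ := φ) (f := id)
    (v := fun a => x a) (xs := (default : Fin 0 → M)) x (by simp)
  have h2 := BoundedFormula.realize_restrictFreeVar (φ := φ) (f := id)
    (v := fun a => x a) (xs := (default : Fin 0 → M)) y (by intro a; simp [hxy a.1 a.2])
  exact h1.symm.trans h2

/-- quantification over arbitrary many variables -/
theorem Dfn.exs [Nonempty M] {β γ : Type*} {R : (β ⊕ γ → M) → Prop} (h : Dfn L R) :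
    Dfn L (fun x : β → M => ∃ e : γ → M, R (Sum.elim x e)) := by
  classical
  obtain ⟨F, hF⟩ := h.finsupp
  by_cases hg : Nonempty (β ⊕ Unit)
  · let G : Finset γ := F.preimage Sum.inr Sum.inr_injective.injOn
    obtain ⟨φ, hφ⟩ := h
    cases isEmpty_or_nonempty G with
    | inl hG =>
      cases isEmpty_or_nonempty β with
      | inl hb =>
        by_cases hh : ∃ x : β ⊕ γ → M, R x
        · obtain ⟨x, hx⟩ := hh
          refine ⟨⊤, fun y => ?_⟩
          simp only [Formula.realize_top, true_iff]
          refine ⟨x ∘ Sum.inr, ?_⟩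
          have : Sum.elim y (x ∘ Sum.inr) = x := by
            funext i; cases i with
            | inl b => exact (hb.false b).elim
            | inr c => rfl
          rwa [this]
        · refine ⟨⊥, fun y => ?_⟩
          simp only [Formula.realize_bot, false_iff]
          rintro ⟨e, he⟩
          exact hh ⟨_, he⟩
      | inr hb =>
        let b := Classical.choice hb
        refine ⟨φ.relabel (Sum.elim id (fun _ => b)), fun y => ?_⟩
        rw [Formula.realize_relabel, hφ]
        constructor
        · intro hR
          refine ⟨fun _ => y b, ?_⟩
          convert hR using 1
          funext i; cases i <;> rfl
        · rintro ⟨e, he⟩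
          rw [← hF _ _ ?_]
          · exact he
          · intro i hi
            cases i with
            | inl b => rfl
            | inr c => exact (hG.false ⟨c, by simpa [G] using hi⟩).elim
    | inr hG =>
      let g0 : G := Classical.choice hG
      let g : β ⊕ γ → β ⊕ G := Sum.elim Sum.inl
        (fun c => if hc : c ∈ G then Sum.inr ⟨c, hc⟩ else Sum.inr g0)
      refine ⟨(φ.relabel g).iExs G, fun y => ?_⟩
      rw [Formula.realize_iExs]
      constructor
      · rintro ⟨e, he⟩
        rw [Formula.realize_relabel, hφ] at he
        refine ⟨fun c => Sum.elim y e (g (Sum.inr c)), ?_⟩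
        convert he using 1
        funext i; cases i <;> rfl
      · rintro ⟨e, he⟩
        refine ⟨fun c => e c, ?_⟩
        rw [Formula.realize_relabel, hφ, ← hF _ _ ?_]
        · exact he
        · intro i hi
          cases i with
          | inl b => rfl
          | inr c =>
            have : c ∈ G := by simpa [G] using hi
            simp [g, this]
  · exact absurd ⟨Sum.inr ()⟩ hg

theorem Dfn.alls [Nonempty M] {β γ : Type*} {R : (β ⊕ γ → M) → Prop} (h : Dfn L R) :
    Dfn L (fun x : β → M => ∀ e : γ → M, R (Sum.elim x e)) :=
  (h.not.exs.not).congr fun x => by push Not; rfl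

theorem Dfn.ex {α : Type*} {R : (α → M) → M → Prop}
    (h : Dfn L (fun x : Option α → M => R (fun i => x (some i)) (x none))) :
    Dfn L (fun x : α → M => ∃ y, R x y) := by
  obtain ⟨φ, hφ⟩ := h
  refine ⟨(φ.relabel (fun o : Option α => o.elim (Sum.inr ()) Sum.inl)).iExs Unit, fun x => ?_⟩
  rw [Formula.realize_iExs]
  constructor
  · rintro ⟨e, he⟩
    rw [Formula.realize_relabel, hφ] at he
    exact ⟨e (), he⟩
  · rintro ⟨y, hy⟩
    refine ⟨fun _ => y, ?_⟩
    rw [Formula.realize_relabel, hφ]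
    exact hy

theorem Dfn.all {α : Type*} {R : (α → M) → M → Prop}
    (h : Dfn L (fun x : Option α → M => R (fun i => x (some i)) (x none))) :
    Dfn L (fun x : α → M => ∀ y, R x y) :=
  (Dfn.ex (R := fun x y => ¬ R x y) h.not).not.congr fun x => by push Not; rfl

theorem Dfn.bAll {α ι : Type*} [Finite ι] {R : ι → (α → M) → Prop} (h : ∀ i, Dfn L (R i)) :
    Dfn L (fun x : α → M => ∀ i, R i x) := by
  choose φ hφ using h
  exact ⟨Formula.iInf φ, fun x => by
    rw [Formula.realize_iInf]; exact forall_congr' fun i => hφ i x⟩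

theorem Dfn.bEx {α ι : Type*} [Finite ι] {R : ι → (α → M) → Prop} (h : ∀ i, Dfn L (R i)) :
    Dfn L (fun x : α → M => ∃ i, R i x) := by
  choose φ hφ using h
  exact ⟨Formula.iSup φ, fun x => by
    rw [Formula.realize_iSup]; exact exists_congr fun i => hφ i x⟩

end dfn
end DiscMod

namespace DiscMod

/-- extend a valuation by one more value -/
def ext {α : Type*} {M : Type*} (a : α → M) (x : M) : Option α → M := fun o => o.elim x a

@[simp] theorem ext_none {α : Type*} {M : Type*} (a : α → M) (x : M) : ext a x none = x := rfl
@[simp] theorem ext_some {α : Type*} {M : Type*} (a : α → M) (x : M) (i : α) :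
    ext a x (some i) = a i := rfl

theorem countable_formula {L : FirstOrder.Language.{u, v}} (hL : L.card ≤ ℵ₀) {α : Type}
    [Countable α] : Countable (L.Formula α) := by
  have h := BoundedFormula.card_le (L := L) (α := α)
  have h2 : #(Σ n, L.BoundedFormula α n) ≤ ℵ₀ := by
    refine h.trans (max_le le_rfl ?_)
    have h3 : Cardinal.lift.{max u v} #α ≤ ℵ₀ := by simp
    have h4 : Cardinal.lift.{0} L.card ≤ ℵ₀ := by simpa using hL
    calc _ ≤ ℵ₀ + ℵ₀ := add_le_add h3 h4
      _ = ℵ₀ := by simp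
  rw [Cardinal.mk_le_aleph0_iff] at h2
  exact Function.Injective.countable (f := fun φ : L.Formula α => (⟨0, φ⟩ : Σ n, L.BoundedFormula α n))
    (fun a b h => by simpa using h)

/-- generic sequences -/
theorem generic {B : Type*} (good : Set B → Prop) {J : Type*} [Countable J] [Nonempty J]
    (task : J → Set B → Prop) (B0 : Set B) (h0 : good B0)
    (hd : ∀ j S, good S → ∃ S', S' ⊆ S ∧ good S' ∧ task j S') :
    ∃ f : ℕ → Set B, Antitone f ∧ (∀ n, good (f n)) ∧ ∀ j, ∃ n, task j (f n) := by
  obtain ⟨en, hen⟩ := exists_surjective_nat J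
  choose! nx h1 h2 h3 using hd
  let f : ℕ → Set B := fun n => Nat.rec B0 (fun n S => nx (en n) S) n
  have hf : ∀ n, f (n + 1) = nx (en n) (f n) := fun n => rfl
  have hg : ∀ n, good (f n) := by
    intro n
    induction n with
    | zero => exact h0
    | succ n ih => rw [hf]; exact h2 _ _ ih
  refine ⟨f, antitone_nat_of_succ_le fun n => ?_, hg, fun j => ?_⟩
  · rw [hf]; exact h1 _ _ (hg n)
  · obtain ⟨n, rfl⟩ := hen j
    exact ⟨n + 1, by rw [hf]; exact h3 _ _ (hg n)⟩

theorem omitting {L : FirstOrder.Language.{u, v}} (hL : L.card ≤ ℵ₀) {M : Type w} [L.Structure M]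
    [Infinite M] {α : Type} [Countable α] (a : α → M) (O : Set (L.Formula (Option α)))
    (hO : ∀ R : (Option α → M) → Prop, Dfn L R → (∃ x, R (ext a x)) →
      ∃ o ∈ O, ∃ x, R (ext a x) ∧ o.Realize (ext a x)) :
    ∃ (S : L.Structure ℕ) (a' : α → ℕ), (∀ φ : L.Formula α, φ.Realize a' ↔ φ.Realize a) ∧
      ∀ b : ℕ, ∃ o ∈ O, o.Realize (ext a' b) := by
  classical
  haveI := countable_formula hL (α := α ⊕ ℕ)
  haveI := countable_formula hL (α := Option (α ⊕ ℕ))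
  let good : Set (ℕ → M) → Prop := fun B => B.Nonempty ∧
    ∃ R : (α ⊕ ℕ → M) → Prop, Dfn L R ∧ B = {e | R (Sum.elim a e)}
  let task : L.Formula (Option (α ⊕ ℕ)) ⊕ ℕ → Set (ℕ → M) → Prop := fun j B =>
    Sum.elim (fun θ => (∀ e ∈ B, ¬ ∃ x, θ.Realize (ext (Sum.elim a e) x)) ∨
        ∃ j, ∀ e ∈ B, θ.Realize (ext (Sum.elim a e) (e j)))
      (fun j => ∃ o ∈ O, ∀ e ∈ B, o.Realize (ext a (e j))) j
  obtain ⟨f, hanti, hgood, htask⟩ := generic good task Set.univ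
    ⟨Set.univ_nonempty, fun _ => True, Dfn.const True, by simp⟩ (by
      rintro (θ | j) S ⟨hne, R, hR, rfl⟩
      · by_cases hc : ∃ e, R (Sum.elim a e) ∧ ∃ x, θ.Realize (ext (Sum.elim a e) x)
        · obtain ⟨e, he, x, hx⟩ := hc
          obtain ⟨F, hF⟩ := hR.finsupp
          obtain ⟨G, hG⟩ := (Dfn.of (M := M) θ).finsupp
          obtain ⟨j, hj⟩ := Infinite.exists_notMem_finset
            ((F.image (fun i => Sum.elim (fun _ => 0) id i)) ∪
              (G.image (fun i : Option (α ⊕ ℕ) => i.elim 0 (fun i => Sum.elim (fun _ => 0) id i))))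
          simp only [Finset.mem_union, Finset.mem_image, not_or, not_exists, not_and] at hj
          refine ⟨{e | R (Sum.elim a e) ∧ θ.Realize (ext (Sum.elim a e) (e j))},
            fun e he => he.1, ⟨⟨Function.update e j x, ?_, ?_⟩, ?_⟩, Or.inr ⟨j, fun e he => he.2⟩⟩
          · refine (hF _ _ ?_).1 he
            rintro (i | i) hi
            · rfl
            · have : i ≠ j := hj.1 (Sum.inr i) hi
              show e i = Function.update e j x i
              rw [Function.update_of_ne this]
          · refine (hG _ _ ?_).1 hx
            rintro (_ | i | i) hi
            · show x = Function.update e j x j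
              rw [Function.update_self]
            · rfl
            · have : i ≠ j := hj.2 (some (Sum.inr i)) hi
              show e i = Function.update e j x i
              rw [Function.update_of_ne this]
          · refine ⟨fun y => R y ∧ θ.Realize (ext y (y (Sum.inr j))), hR.and ?_, rfl⟩
            refine ((Dfn.of (M := M) θ).sub (fun o => o.elim (Sum.inr j) id)).congr fun y => ?_
            have : (fun i => y (Option.elim i (Sum.inr j) id)) = ext y (y (Sum.inr j)) := by
              funext i; cases i <;> rfl
            rw [this]
        · exact ⟨_, le_rfl, ⟨hne, R, hR, rfl⟩, Or.inl fun e he hx => hc ⟨e, he, hx⟩⟩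
      · obtain ⟨e, he⟩ := hne
        let R' : (Option α → M) → Prop := fun y => ∃ e : ℕ → M,
          R (Sum.elim (fun i => y (some i)) e) ∧ e j = y none
        have hR' : Dfn L R' := by
          have h1 : Dfn L (fun y : (Option α) ⊕ ℕ → M => R (fun i => y (Sum.map some id i)) ∧
              y (Sum.inr j) = y (Sum.inl none)) := (hR.sub _).and (Dfn.eq _ _)
          refine h1.exs.congr fun y => exists_congr fun e => ?_
          have : (fun i => Sum.elim y e (Sum.map some id i)) =
            Sum.elim (fun i => y (some i)) e := by funext i; cases i <;> rfl
          rw [this]; rfl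
        obtain ⟨o, ho, x, ⟨e', he', hx⟩, h2⟩ := hO R' hR' ⟨e j, e, he, rfl⟩
        refine ⟨{e | R (Sum.elim a e) ∧ o.Realize (ext a (e j))}, fun e he => he.1,
          ⟨⟨e', he', ?_⟩, fun y => R y ∧ o.Realize (ext (fun i => y (Sum.inl i)) (y (Sum.inr j))),
            hR.and ?_, rfl⟩, o, ho, fun e he => he.2⟩
        · simp only [ext_none] at hx
          rw [hx]; exact h2
        · refine ((Dfn.of (M := M) o).sub (fun o => o.elim (Sum.inr j) Sum.inl)).congr fun y => ?_
          have : (fun i => y (Option.elim i (Sum.inr j) Sum.inl)) =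
              ext (fun i => y (Sum.inl i)) (y (Sum.inr j)) := by
            funext i; cases i <;> rfl
          rw [this])
  choose e he using fun n => (hgood n).1
  let U : Ultrafilter ℕ := Filter.hyperfilter ℕ
  let P := (U : Filter ℕ).Product (fun _ => M)
  let mk : (ℕ → M) → P := fun x => (x : (U : Filter ℕ).Product (fun _ => M))
  have los : ∀ {β : Type} (φ : L.Formula β) (x : β → ℕ → M),
      φ.Realize (fun i => mk (x i)) ↔ ∀ᶠ n in (U : Filter ℕ), φ.Realize fun i => x i n :=
    fun φ x => Ultraproduct.realize_formula_cast φ x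
  have hU : ∀ m, ∀ᶠ n in (U : Filter ℕ), m ≤ n := by
    intro m
    have : (Filter.hyperfilter ℕ : Filter ℕ) ≤ Filter.atTop := by
      rw [← Nat.cofinite_eq_atTop]; exact Filter.hyperfilter_le_cofinite
    exact this (Filter.eventually_ge_atTop m)
  let vv : ℕ → P := fun j => mk (fun n => e n j)
  let A : α → P := fun i => mk (fun _ => a i)
  have hH : ∀ θ : L.Formula (Option (α ⊕ ℕ)), (∃ x, θ.Realize (ext (Sum.elim A vv) x)) →
      ∃ j, θ.Realize (ext (Sum.elim A vv) (vv j)) := by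
    rintro θ ⟨x, hx⟩
    have key : ∀ z : ℕ → M, θ.Realize (ext (Sum.elim A vv) (mk z)) ↔
        ∀ᶠ n in (U : Filter ℕ), θ.Realize (ext (Sum.elim a (e n)) (z n)) := by
      intro z
      have := los θ (ext (Sum.elim (fun i _ => a i) (fun j n => e n j)) z)
      convert this using 2
      · funext i
        rcases i with _ | i | i <;> rfl
      · funext n
        congr 1
        funext i
        rcases i with _ | i | i <;> rfl
    obtain ⟨m, hm⟩ := htask (Sum.inl θ)
    rcases hm with hm | ⟨j, hj⟩
    · exfalso
      obtain ⟨z, rfl⟩ : ∃ z, mk z = x := Quotient.exists_rep x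
      rw [key] at hx
      obtain ⟨n, hn, hn'⟩ := (hx.and (hU m)).exists
      exact hm (e n) (hanti hn' (he n)) ⟨_, hn⟩
    · refine ⟨j, (key _).2 ?_⟩
      filter_upwards [hU m] with n hn
      exact hj (e n) (hanti hn (he n))
  let S0 : L.Substructure P :=
    { carrier := Set.range vv
      fun_mem := by
        intro n fn x hx
        choose js hjs using hx
        obtain ⟨j, hj⟩ := hH (Term.equal (Term.var none)
          (Term.func fn (fun i => Term.var (some (Sum.inr (js i))))))
          ⟨Structure.funMap fn x, by
            simp [Formula.realize_equal, hjs]⟩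
        refine ⟨j, ?_⟩
        simpa [Formula.realize_equal, hjs] using hj }
  have hS0 : ∀ x : S0, ∃ j, vv j = x := fun x => x.2
  let S : L.ElementarySubstructure P := S0.toElementarySubstructure (by
    intro n φ x b hb
    choose js hjs using fun i => hS0 (x i)
    let g : Empty ⊕ Fin (n + 1) → Option (α ⊕ ℕ) :=
      Sum.elim Empty.elim (Fin.snoc (α := fun _ => Option (α ⊕ ℕ)) (fun i => some (Sum.inr (js i))) none)
    have key : ∀ y, (φ.toFormula.relabel g).Realize (ext (Sum.elim A vv) y) ↔
        φ.Realize default (Fin.snoc (α := fun _ => P) ((↑) ∘ x) y : _ → P) := by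
      intro y
      rw [Formula.realize_relabel, BoundedFormula.realize_toFormula]
      have h1 : (ext (Sum.elim A vv) y ∘ g) ∘ Sum.inl = (default : Empty → P) :=
        Subsingleton.elim _ _
      have h2 : (ext (Sum.elim A vv) y ∘ g) ∘ Sum.inr =
          (Fin.snoc (α := fun _ => P) ((↑) ∘ x) y : _ → P) := by
        funext i
        refine Fin.lastCases ?_ (fun i => ?_) i
        · simp [g]
        · simp [g, hjs]
      rw [h1, h2]
    obtain ⟨j, hj⟩ := hH (φ.toFormula.relabel g) ⟨b, (key b).2 hb⟩
    exact ⟨⟨vv j, j, rfl⟩, (key _).1 hj⟩)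
  have hAS : ∀ i, ∃ j, vv j = A i := by
    intro i
    obtain ⟨j, hj⟩ := hH (Term.equal (Term.var none) (Term.var (some (Sum.inl i))))
      ⟨A i, by simp [Formula.realize_equal]⟩
    exact ⟨j, by simpa [Formula.realize_equal] using hj⟩
  have hSP : S ≅[L] P := S.elementarilyEquivalent
  have hPM : P ≅[L] M := by
    rw [elementarilyEquivalent_iff]
    intro φ
    have := Ultraproduct.sentence_realize (M := fun _ : ℕ => M) (u := U) φ
    refine this.trans ?_
    simp
  haveI : Infinite P := hPM.symm.infinite
  haveI : Infinite S := hSP.symm.infinite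
  haveI : Countable S := (Set.countable_range vv).to_subtype
  obtain ⟨en⟩ : Nonempty (S ≃ ℕ) := nonempty_equiv_of_countable
  letI : L.Structure ℕ := en.inducedStructure
  let g : S ≃[L] ℕ := en.inducedStructureEquiv
  have hcoe : ∀ x, g x = en x := fun x => rfl
  let as : α → S := fun i => ⟨A i, hAS i⟩
  have hreal : ∀ {β : Type} (φ : L.Formula β) (x : β → S),
      φ.Realize (fun i => g (x i)) ↔ φ.Realize (fun i => (x i : P)) := by
    intro β φ x
    have h1 : φ.Realize (g ∘ x) ↔ φ.Realize x := StrongHomClass.realize_formula g φ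
    have h2 : φ.Realize (S.subtype ∘ x) ↔ φ.Realize x := S.subtype.map_formula φ x
    exact h1.trans h2.symm
  refine ⟨inferInstance, fun i => g (as i), fun φ => ?_, fun b => ?_⟩
  · rw [hreal]
    have := los φ (fun i _ => a i)
    refine this.trans ?_
    simp
  · obtain ⟨⟨_, j, rfl⟩, rfl⟩ := g.surjective b
    obtain ⟨m, o, ho, hm⟩ := htask (Sum.inr j)
    refine ⟨o, ho, ?_⟩
    have h1 := hreal o (ext as ⟨vv j, j, rfl⟩)
    have h2 : (fun i => g (ext as ⟨vv j, j, rfl⟩ i)) =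
      ext (fun i => g (as i)) (g ⟨vv j, j, rfl⟩) := by funext i; cases i <;> rfl
    rw [h2] at h1
    rw [h1]
    have h3 := los o (ext (fun i _ => a i) (fun n => e n j))
    have h4 : (fun i => mk (ext (fun i _ => a i) (fun n => e n j) i)) =
        (fun i => ((ext as ⟨vv j, j, rfl⟩ i : S) : P)) := by funext i; cases i <;> rfl
    rw [h4] at h3
    rw [h3]
    filter_upwards [hU m] with n hn
    have h5 := hm (e n) (hanti hn (he n))
    convert h5 using 1
    funext i; cases i <;> rfl

end DiscMod

namespace DiscMod

/-- A definable linear order with an initial segment of type `ω` enumerated by `c`. -/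
structure OSeq (L : FirstOrder.Language.{u, v}) {M : Type w} [L.Structure M] (D : M → Prop)
    (lt : M → M → Prop) (c : ℕ → M) : Prop where
  dD : Dfn L (fun x : Unit → M => D (x ()))
  dlt : Dfn L (fun x : Fin 2 → M => lt (x 0) (x 1))
  ltD : ∀ x y, lt x y → D x ∧ D y
  irr : ∀ x, ¬ lt x x
  trans : ∀ x y z, lt x y → lt y z → lt x z
  tot : ∀ x y, D x → D y → x = y ∨ lt x y ∨ lt y x
  cD : ∀ i, D (c i)
  clt : ∀ i j, i < j → lt (c i) (c j)
  ini : ∀ i x, lt x (c i) → ∃ j, c j = x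

/-- Relation on natural numbers traced by a formula along `c`. -/
def Tr (L : FirstOrder.Language.{u, v}) {M : Type w} [L.Structure M] (c : ℕ → M) {α : Type*}
    (R : (α → ℕ) → Prop) : Prop :=
  ∃ φ : L.Formula α, ∀ i : α → ℕ, φ.Realize (fun a => c (i a)) ↔ R i

section
variable {L : FirstOrder.Language.{u, v}} {M : Type w} [L.Structure M] {D : M → Prop}
    {lt : M → M → Prop} {c : ℕ → M}

theorem Tr.of {α : Type*} {Q : (α → M) → Prop} (h : Dfn L Q) :
    Tr L c (fun i : α → ℕ => Q (fun a => c (i a))) := by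
  obtain ⟨φ, hφ⟩ := h
  exact ⟨φ, fun i => hφ _⟩

theorem Tr.congr {α : Type*} {R S : (α → ℕ) → Prop} (h : Tr L c R) (e : ∀ x, R x ↔ S x) :
    Tr L c S := by
  obtain ⟨φ, hφ⟩ := h
  exact ⟨φ, fun x => (hφ x).trans (e x)⟩

theorem Tr.not {α : Type*} {R : (α → ℕ) → Prop} (h : Tr L c R) : Tr L c (fun x => ¬ R x) := by
  obtain ⟨φ, hφ⟩ := h
  exact ⟨φ.not, fun x => by rw [Formula.realize_not, hφ]⟩

theorem Tr.and {α : Type*} {R S : (α → ℕ) → Prop} (h : Tr L c R) (h' : Tr L c S) :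
    Tr L c (fun x => R x ∧ S x) := by
  obtain ⟨φ, hφ⟩ := h
  obtain ⟨ψ, hψ⟩ := h'
  exact ⟨φ ⊓ ψ, fun x => by rw [Formula.realize_inf, hφ, hψ]⟩

theorem Tr.iff {α : Type*} {R S : (α → ℕ) → Prop} (h : Tr L c R) (h' : Tr L c S) :
    Tr L c (fun x => R x ↔ S x) := by
  obtain ⟨φ, hφ⟩ := h
  obtain ⟨ψ, hψ⟩ := h'
  exact ⟨φ.iff ψ, fun x => by rw [Formula.realize_iff, hφ, hψ]⟩

theorem Tr.sub {α β : Type*} {R : (α → ℕ) → Prop} (h : Tr L c R) (g : α → β) :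
    Tr L c (fun x : β → ℕ => R (fun i => x (g i))) := by
  obtain ⟨φ, hφ⟩ := h
  exact ⟨φ.relabel g, fun x => by
    rw [Formula.realize_relabel]; exact hφ (fun i => x (g i))⟩

theorem Tr.finsupp {α : Type*} {R : (α → ℕ) → Prop} (h : Tr L c R) :
    ∃ F : Finset α, ∀ x y : α → ℕ, (∀ i ∈ F, x i = y i) → (R x ↔ R y) := by
  obtain ⟨φ, hφ⟩ := h
  obtain ⟨F, hF⟩ := (Dfn.of (M := M) φ).finsupp
  refine ⟨F, fun x y hxy => ?_⟩
  rw [← hφ, ← hφ]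
  exact hF _ _ fun i hi => by rw [hxy i hi]

theorem OSeq.asymm (h : OSeq L D lt c) {x y : M} (h1 : lt x y) (h2 : lt y x) : False :=
  h.irr _ (h.trans _ _ _ h1 h2)

theorem OSeq.clt_iff (h : OSeq L D lt c) {i j : ℕ} : lt (c i) (c j) ↔ i < j := by
  refine ⟨fun hl => ?_, h.clt i j⟩
  by_contra hn
  rcases (not_lt.1 hn).lt_or_eq with h1 | h1
  · exact h.asymm hl (h.clt _ _ h1)
  · subst h1; exact h.irr _ hl

theorem OSeq.inj (h : OSeq L D lt c) {i j : ℕ} (e : c i = c j) : i = j := by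
  rcases lt_trichotomy i j with h1 | h1 | h1
  · have := h.clt _ _ h1; rw [e] at this; exact (h.irr _ this).elim
  · exact h1
  · have := h.clt _ _ h1; rw [e] at this; exact (h.irr _ this).elim

/-- covering relation -/
def Cov (lt : M → M → Prop) (x y : M) : Prop := lt x y ∧ ∀ z, ¬ (lt x z ∧ lt z y)

theorem OSeq.dlt' (h : OSeq L D lt c) {α : Type*} (i j : α) :
    Dfn L (fun x : α → M => lt (x i) (x j)) :=
  (h.dlt.sub ![i, j]).congr fun x => by simp

theorem OSeq.dD' (h : OSeq L D lt c) {α : Type*} (i : α) :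
    Dfn L (fun x : α → M => D (x i)) :=
  (h.dD.sub (fun _ => i))

theorem OSeq.dcov (h : OSeq L D lt c) {α : Type*} (i j : α) :
    Dfn L (fun x : α → M => Cov lt (x i) (x j)) := by
  refine (h.dlt' i j).and (Dfn.all (R := fun x z => ¬ (lt (x i) z ∧ lt z (x j))) ?_)
  exact ((h.dlt' (some i) none).and (h.dlt' none (some j))).not

theorem OSeq.cov_iff (h : OSeq L D lt c) {i : ℕ} {x : M} : Cov lt (c i) x ↔ x = c (i + 1) := by
  constructor
  · rintro ⟨h1, h2⟩
    rcases h.tot x (c (i+1)) (h.ltD _ _ h1).2 (h.cD _) with e | e | e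
    · exact e
    · obtain ⟨j, rfl⟩ := h.ini _ _ e
      rw [h.clt_iff] at e h1; omega
    · exact (h2 _ ⟨h.clt _ _ (Nat.lt_succ_self i), e⟩).elim
  · rintro rfl
    refine ⟨h.clt _ _ (Nat.lt_succ_self i), fun z hz => ?_⟩
    obtain ⟨j, rfl⟩ := h.ini _ _ hz.2
    have h1 := h.clt_iff.1 hz.1
    have h2 := h.clt_iff.1 hz.2
    omega

theorem OSeq.cov_iff' (h : OSeq L D lt c) {i : ℕ} {x : M} :
    Cov lt x (c i) ↔ ∃ j, j + 1 = i ∧ x = c j := by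
  constructor
  · intro hx
    obtain ⟨j, rfl⟩ := h.ini _ _ hx.1
    have := h.inj (h.cov_iff.1 hx)
    exact ⟨j, this.symm, rfl⟩
  · rintro ⟨j, rfl, rfl⟩
    exact h.cov_iff.2 rfl

theorem OSeq.deqc (h : OSeq L D lt c) {α : Type*} (i : α) (m : ℕ) :
    Dfn L (fun x : α → M => x i = c m) := by
  induction m generalizing α with
  | zero =>
    have h1 : Dfn L (fun x : α → M => D (x i) ∧ ∀ y, ¬ lt y (x i)) :=
      (h.dD' i).and (Dfn.all (R := fun x z => ¬ lt z (x i)) (h.dlt' none (some i)).not)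
    refine h1.congr fun x => ⟨fun hx => ?_, fun hx => ?_⟩
    · rcases h.tot _ (c 0) hx.1 (h.cD 0) with e | e | e
      · exact e
      · obtain ⟨j, hj⟩ := h.ini _ _ e
        rw [← hj, h.clt_iff] at e; omega
      · exact (hx.2 _ e).elim
    · rw [hx]
      refine ⟨h.cD _, fun y hy => ?_⟩
      obtain ⟨j, rfl⟩ := h.ini _ _ hy
      rw [h.clt_iff] at hy; omega
  | succ m ih =>
    have h1 : Dfn L (fun x : α → M => ∃ y, y = c m ∧ Cov lt y (x i)) :=
      Dfn.ex (R := fun x y => y = c m ∧ Cov lt y (x i)) ((ih none).and (h.dcov none (some i)))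
    refine h1.congr fun x => ?_
    simp [h.cov_iff]

theorem OSeq.tlt (h : OSeq L D lt c) {α : Type*} (a b : α) :
    Tr L c (fun i : α → ℕ => i a < i b) :=
  (Tr.of (c := c) (h.dlt' a b)).congr fun i => h.clt_iff

theorem OSeq.tbex (h : OSeq L D lt c) {α : Type*} {R : (α → ℕ) → ℕ → Prop} (a : α)
    (hR : Tr L c (fun t : Option α → ℕ => R (fun b => t (some b)) (t none))) :
    Tr L c (fun i => ∃ j, j < i a ∧ R i j) := by
  obtain ⟨φ, hφ⟩ := hR
  have h1 : Dfn L (fun x : α → M => ∃ y, lt y (x a) ∧ φ.Realize (ext x y)) := by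
    refine Dfn.ex (R := fun x y => lt y (x a) ∧ φ.Realize (ext x y)) ?_
    refine (h.dlt' none (some a)).and ((Dfn.of (M := M) φ).congr fun x => ?_)
    have : ext (fun i => x (some i)) (x none) = x := by funext i; cases i <;> rfl
    rw [this]
  have key : ∀ (i : α → ℕ) (j : ℕ), φ.Realize (ext (fun b => c (i b)) (c j)) ↔ R i j := by
    intro i j
    have := hφ (ext i j)
    simp only [ext_none, ext_some] at this
    rw [← this]
    have : (fun a => c (ext i j a)) = ext (fun b => c (i b)) (c j) := by funext i; cases i <;> rfl
    rw [this]
  refine (Tr.of (c := c) h1).congr fun i => ⟨?_, ?_⟩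
  · rintro ⟨y, hy, hy2⟩
    obtain ⟨j, rfl⟩ := h.ini _ _ hy
    exact ⟨j, h.clt_iff.1 hy, (key _ _).1 hy2⟩
  · rintro ⟨j, hj, hj2⟩
    exact ⟨c j, h.clt_iff.2 hj, (key _ _).2 hj2⟩

theorem OSeq.tball (h : OSeq L D lt c) {α : Type*} {R : (α → ℕ) → ℕ → Prop} (a : α)
    (hR : Tr L c (fun t : Option α → ℕ => R (fun b => t (some b)) (t none))) :
    Tr L c (fun i => ∀ j, j < i a → R i j) :=
  (h.tbex (R := fun i j => ¬ R i j) a hR.not).not.congr fun i => by push Not; rfl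

/-- definable functional substitution -/
theorem Tr.subst {α : Type*} {R : (Option α → ℕ) → Prop} (hR : Tr L c R)
    {G : (α → ℕ) → ℕ} {Q : (α → M) → M → Prop}
    (hQ : Dfn L (fun x : Option α → M => Q (fun i => x (some i)) (x none)))
    (hG : ∀ i x, Q (fun a => c (i a)) x ↔ x = c (G i)) :
    Tr L c (fun i => R (ext i (G i))) := by
  obtain ⟨φ, hφ⟩ := hR
  have h1 : Dfn L (fun x : α → M => ∃ y, Q x y ∧ φ.Realize (ext x y)) := by
    refine Dfn.ex (R := fun x y => Q x y ∧ φ.Realize (ext x y)) ?_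
    refine hQ.and ((Dfn.of (M := M) φ).congr fun x => ?_)
    have : ext (fun i => x (some i)) (x none) = x := by funext i; cases i <;> rfl
    rw [this]
  refine (Tr.of (c := c) h1).congr fun i => ?_
  simp only [hG, exists_eq_left]
  rw [← hφ]
  have : (fun a => c (ext i (G i) a)) = ext (fun b => c (i b)) (c (G i)) := by
    funext i; cases i <;> rfl
  rw [this]

theorem OSeq.tzero (h : OSeq L D lt c) {α : Type*} {R : (Option α → ℕ) → Prop} (hR : Tr L c R) :
    Tr L c (fun i => R (ext i 0)) :=
  hR.subst (G := fun _ => 0) (Q := fun _ y => y = c 0) (h.deqc none 0) (fun _ _ => Iff.rfl)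

theorem OSeq.tsucc (h : OSeq L D lt c) {α : Type*} {R : (Option α → ℕ) → Prop} (hR : Tr L c R)
    (a : α) : Tr L c (fun i => R (ext i (i a + 1))) :=
  hR.subst (G := fun i => i a + 1) (Q := fun x y => Cov lt (x a) y) (h.dcov (some a) none)
    (fun _ _ => h.cov_iff)

theorem OSeq.tshift1 (h : OSeq L D lt c) {α : Type*} [DecidableEq α] {R : (α → ℕ) → Prop}
    (hR : Tr L c R) (a : α) : Tr L c (fun i => R (Function.update i a (i a + 1))) := by
  refine (h.tsucc (hR.sub (fun b => if b = a then none else some b)) a).congr fun i => ?_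
  have : (fun b => ext i (i a + 1) (if b = a then none else some b)) =
      Function.update i a (i a + 1) := by
    funext b
    by_cases hb : b = a
    · subst hb; simp
    · simp [hb]
  rw [this]

theorem OSeq.tshiftk (h : OSeq L D lt c) {α : Type*} [DecidableEq α] {R : (α → ℕ) → Prop}
    (hR : Tr L c R) (a : α) (k : ℕ) : Tr L c (fun i => R (Function.update i a (i a + k))) := by
  induction k with
  | zero => simpa using hR
  | succ k ih =>
    refine (h.tshift1 ih a).congr fun i => ?_
    simp only [Function.update_self, Function.update_idem]
    rw [show i a + 1 + k = i a + (k + 1) by omega]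

theorem OSeq.tshift (h : OSeq L D lt c) {α : Type*} [Fintype α] {R : (α → ℕ) → Prop}
    (hR : Tr L c R) (s : α → ℕ) : Tr L c (fun i => R (fun b => i b + s b)) := by
  classical
  have : ∀ F : Finset α, Tr L c (fun i => R (fun b => i b + if b ∈ F then s b else 0)) := by
    intro F
    induction F using Finset.induction_on with
    | empty => simpa using hR
    | insert a F ha ih =>
      refine (h.tshiftk ih a (s a)).congr fun i => ?_
      have : (fun b => Function.update i a (i a + s a) b + if b ∈ F then s b else 0) =
          (fun b => i b + if b ∈ insert a F then s b else 0) := by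
        funext b
        by_cases hb : b = a
        · subst hb; simp [ha]
        · simp [hb]
      rw [this]
  simpa using this Finset.univ

theorem OSeq.tterm (h : OSeq L D lt c) {α β : Type*} [Fintype β] {R : (β → ℕ) → Prop}
    (hR : Tr L c R) (g : β → α) (s : β → ℕ) : Tr L c (fun i : α → ℕ => R (fun b => i (g b) + s b)) :=
  ((h.tshift hR s).sub g)

/-- relations are constant on sufficiently spread tuples -/
def Cst (L : FirstOrder.Language.{u, v}) {M : Type w} [L.Structure M] (c : ℕ → M) {α : Type*}
    (S : ℕ → (α → ℕ) → Prop) : Prop :=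
  ∀ R : (α → ℕ) → Prop, Tr L c R → ∃ K : ℕ, ∃ v : Prop, ∀ u, S K u → (R u ↔ v)

/-- extend a notion of spread tuple by one more variable -/
def nx {α : Type*} (S : ℕ → (α → ℕ) → Prop) (a0 : α) : ℕ → (Option α → ℕ) → Prop :=
  fun K t => S K (fun a => t (some a)) ∧ t (some a0) + K ≤ t none

theorem cst_step (h : OSeq L D lt c) {α : Type*} [Fintype α] (S : ℕ → (α → ℕ) → Prop) (a0 : α)
    (mono : ∀ K K' u, K ≤ K' → S K' u → S K u) (ne : ∀ K, ∃ u, S K u)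
    (hC : Cst L c (nx S a0)) : Cst L c (nx (nx S a0) none) := by
  intro R0 hR0
  -- currying
  obtain ⟨R, hRdef⟩ : ∃ R : (α → ℕ) → ℕ → ℕ → Prop, ∀ u y z, R u y z ↔ R0 (ext (ext u y) z) :=
    ⟨_, fun _ _ _ => Iff.rfl⟩
  have hR0' : ∀ t, R0 t ↔ R (fun a => t (some (some a))) (t (some none)) (t none) := by
    intro t
    rw [hRdef]
    have : ext (ext (fun a => t (some (some a))) (t (some none))) (t none) = t := by
      funext i; rcases i with _ | _ | i <;> rfl
    rw [this]
  have hRt : ∀ {β : Type _} (g : α → β) (y z : β) (k l : ℕ),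
      Tr L c (fun i : β → ℕ => R (fun a => i (g a)) (i y + k) (i z + l)) := by
    intro β g y z k l
    refine (h.tterm hR0 (ext (ext g y) z) (ext (ext (fun _ => 0) k) l)).congr fun i => ?_
    rw [hR0']; rfl
  have hC' : ∀ Q : (α → ℕ) → ℕ → Prop, Tr L c (fun t : Option α → ℕ => Q (fun a => t (some a))
      (t none)) → ∃ K : ℕ, ∃ v : Prop, ∀ u y, S K u → u a0 + K ≤ y → (Q u y ↔ v) := by
    intro Q hQ
    obtain ⟨K, v, hv⟩ := hC _ hQ
    exact ⟨K, v, fun u y h1 h2 => hv (ext u y) ⟨h1, h2⟩⟩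
  let dl : (α → ℕ) → ℕ → ℕ → Prop := fun u y z => ¬ (R u y z ↔ R u (y+1) (z+1))
  have hdl : ∀ {β : Type _} (g : α → β) (y z : β),
      Tr L c (fun i : β → ℕ => dl (fun a => i (g a)) (i y) (i z)) :=
    fun g y z => ((hRt g y z 0 0).iff (hRt g y z 1 1)).not
  let fz : (α → ℕ) → ℕ → ℕ → Prop := fun u y z => y < z ∧ dl u y z ∧
    ∀ z', z' < z → ¬ (y < z' ∧ dl u y z')
  have hfz : ∀ {β : Type _} (g : α → β) (y z : β),
      Tr L c (fun i : β → ℕ => fz (fun a => i (g a)) (i y) (i z)) := by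
    intro β g y z
    refine (h.tlt y z).and ((hdl g y z).and ?_)
    refine h.tball (R := fun i z' => ¬ (i y < z' ∧ dl (fun a => i (g a)) (i y) z')) z ?_
    exact ((h.tlt (some y) none).and (hdl (fun a => some (g a)) (some y) none)).not
  let Im : (α → ℕ) → ℕ → Prop := fun u z => ∃ y, y < z ∧ (¬ y < u a0 ∧ fz u y z)
  have hIm : Tr L c (fun t : Option α → ℕ => Im (fun a => t (some a)) (t none)) := by
    refine h.tbex (R := fun (t : Option α → ℕ) y => ¬ y < t (some a0) ∧
      fz (fun a => t (some a)) y (t none)) none ?_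
    exact (h.tlt none (some (some a0))).not.and (hfz (fun a => some (some a)) none (some none))
  have main : ∃ K, ∀ u y z, S K u → u a0 + K ≤ y → y + K ≤ z → (R u y z ↔ R u (y+1) (z+1)) := by
    obtain ⟨K1, v1, hv1⟩ := hC' _ hIm
    by_cases v1t : v1
    · exfalso
      choose k v hk using fun l : ℕ => hC' (fun u y => R u (y + 0) (y + l))
        (hRt (fun a => some a) none none 0 l)
      let K2 := max K1 ((Finset.range (K1 + 1)).sup k)
      obtain ⟨u, hu⟩ := ne K2
      have hK1 : K1 ≤ K2 := le_max_left _ _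
      have him : ∀ s, ∃ y, y < u a0 + K1 + s ∧ (¬ y < u a0 ∧ fz u y (u a0 + K1 + s)) := fun s =>
        (hv1 u (u a0 + K1 + s) (mono _ _ _ hK1 hu) (by omega)).2 v1t
      choose y hy1 hy2 hy3 using him
      have hlt : ∀ s, s ≤ K2 → y s < u a0 + K2 := by
        intro s hs
        by_contra hcon
        push Not at hcon
        have h1 := hy1 s
        obtain ⟨l, hl⟩ : ∃ l, u a0 + K1 + s = y s + l := ⟨u a0 + K1 + s - y s, by omega⟩
        have hl1 : l ≤ K1 := by omega
        have hkl : k l ≤ K2 := by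
          refine le_trans ?_ (le_max_right _ _)
          exact Finset.le_sup (f := k) (Finset.mem_range.2 (by omega))
        have e1 := hk l u (y s) (mono _ _ _ hkl hu) (by omega)
        have e2 := hk l u (y s + 1) (mono _ _ _ hkl hu) (by omega)
        have := (hy3 s).2.1
        rw [hl] at this
        apply this
        have e3 := e1.trans e2.symm
        rwa [show y s + 0 = y s from rfl, show y s + 1 + 0 = y s + 1 from rfl,
          show y s + 1 + l = y s + l + 1 by omega] at e3
      obtain ⟨s, hs, s', hs', hne, heq⟩ := Finset.exists_ne_map_eq_of_card_lt_of_maps_to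
        (s := Finset.range (K2 + 1)) (t := Finset.range K2) (by simp)
        (f := fun s => y s - u a0) (fun s hs => by
          simp only [Finset.coe_range, Set.mem_Iio] at hs ⊢
          have := hlt s (by omega)
          have := hy2 s
          omega)
      have hye : y s = y s' := by
        have := hy2 s; have := hy2 s'
        omega
      rcases lt_or_gt_of_ne hne with hl | hl
      · exact (hy3 s').2.2 (u a0 + K1 + s) (by omega) (by
          rw [← hye]; exact ⟨hy1 s, (hy3 s).2.1⟩)
      · exact (hy3 s).2.2 (u a0 + K1 + s') (by omega) (by
          rw [hye]; exact ⟨hy1 s', (hy3 s').2.1⟩)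
    · refine ⟨K1 + 1, fun u y z hu hy hz => ?_⟩
      by_contra hcon
      classical
      have hex : ∃ z, y < z ∧ dl u y z := ⟨z, by omega, hcon⟩
      refine v1t ((hv1 u (Nat.find hex) (mono _ _ _ (by omega) hu) ?_).1 ⟨y, ?_, ?_, ?_, ?_, ?_⟩)
      · have := (Nat.find_spec hex).1; omega
      · exact (Nat.find_spec hex).1
      · omega
      · exact (Nat.find_spec hex).1
      · exact (Nat.find_spec hex).2
      · intro z' hz'
        exact Nat.find_min hex hz'
  obtain ⟨K, hK⟩ := main
  have shift : ∀ m u y z, S K u → u a0 + K ≤ y → y + K ≤ z → (R u y z ↔ R u (y+m) (z+m)) := by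
    intro m u y z hu hy hz
    induction m with
    | zero => rfl
    | succ m ih => exact ih.trans (hK u (y+m) (z+m) hu (by omega) (by omega))
  obtain ⟨K', v', hv'⟩ := hC' (fun u x => R u (u a0 + K) (x + 0))
    (hRt (fun a => some a) (some a0) none K 0)
  refine ⟨K + K', v', fun t ht => ?_⟩
  obtain ⟨⟨h1, h2⟩, h3⟩ := ht
  beta_reduce at h1 h2 h3
  rw [hR0']
  obtain ⟨m, hm⟩ : ∃ m, t (some none) = t (some (some a0)) + K + m :=
    ⟨t (some none) - (t (some (some a0)) + K), by omega⟩
  obtain ⟨z, hz⟩ : ∃ z, t none = z + m := ⟨t none - m, by omega⟩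
  rw [hm, hz, ← shift m _ _ _ (mono _ _ _ (by omega) h1) (by omega) (by omega)]
  exact hv' _ z (mono _ _ _ (by omega) h1) (by omega)

/-- iterated options -/
def OT : ℕ → Type
  | 0 => Unit
  | n + 1 => Option (OT n)

instance OT.fin : (n : ℕ) → Fintype (OT n)
  | 0 => inferInstanceAs (Fintype Unit)
  | n + 1 => @instFintypeOption _ (OT.fin n)

/-- last variable -/
def OT.top : (n : ℕ) → OT n
  | 0 => ()
  | _ + 1 => none

/-- spread tuples -/
def SP : (n : ℕ) → ℕ → (OT n → ℕ) → Prop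
  | 0 => fun _ u => u () = 0
  | n + 1 => nx (SP n) (OT.top n)

theorem SP.mono (n K K' : ℕ) (u : OT n → ℕ) (h : K ≤ K') (hu : SP n K' u) : SP n K u := by
  induction n with
  | zero => exact hu
  | succ n ih => exact ⟨ih _ hu.1, le_trans (by omega) hu.2⟩

theorem SP.ne (n K : ℕ) : ∃ u, SP n K u := by
  induction n with
  | zero => exact ⟨fun _ => 0, rfl⟩
  | succ n ih =>
    obtain ⟨u, hu⟩ := ih
    exact ⟨ext u (u (OT.top n) + K), hu, le_rfl⟩

theorem cst_all (h : OSeq L D lt c)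
    (hs : ∀ R : (Unit → ℕ) → Prop, Tr L c R → ∃ K : ℕ, ∃ v : Prop, ∀ u, K ≤ u () → (R u ↔ v))
    (n : ℕ) : Cst L c (SP n) := by
  have h1 : ∀ n, Cst L c (SP (n + 1)) := by
    intro n
    induction n with
    | zero =>
      intro R hR
      have hR' : Tr L c (fun i : Unit → ℕ => R (ext (fun _ => 0) (i ()))) := by
        refine (h.tzero (hR.sub (fun o : Option Unit => o.elim (some ()) (fun _ => none)))).congr
          fun i => ?_
        have : (fun o : Option Unit => ext i 0 (o.elim (some ()) (fun _ => none))) =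
          ext (fun _ => 0) (i ()) := by funext i; rcases i with _ | _ <;> rfl
        exact Iff.of_eq (congrArg R this)
      obtain ⟨K, v, hv⟩ := hs _ hR'
      refine ⟨K, v, fun u hu => ?_⟩
      rw [← hv (fun _ => u none) (le_trans (by omega) hu.2)]
      have : u = ext (fun _ => 0) (u none) := by
        funext i; rcases i with _ | _
        · rfl
        · exact hu.1
      rw [← this]
    | succ n ih => exact cst_step h (SP n) (OT.top n) (SP.mono n) (SP.ne n) ih
  cases n with
  | zero =>
    intro R hR
    refine ⟨0, R (fun _ => 0), fun u hu => ?_⟩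
    have : u = fun _ => 0 := by funext i; exact hu
    rw [this]
  | succ n => exact h1 n

/-- separated tuples -/
def Sep {α : Type*} (K : ℕ) (F : Finset α) (t : α → ℕ) : Prop :=
  ∀ a ∈ F, K ≤ t a ∧ ∀ b ∈ F, a ≠ b → t a + K < t b ∨ t b + K < t a

theorem sort_sep {α : Type*} (n : ℕ) : ∀ (F : Finset α), F.card = n → ∀ t : α → ℕ, Sep 0 F t →
    ∃ g : α → OT n, ∀ K t', Sep K F t' → (∀ a ∈ F, ∀ b ∈ F, t a < t b ↔ t' a < t' b) →
      ∃ u', SP n K u' ∧ (∀ a ∈ F, t' a = u' (g a)) ∧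
        (F = ∅ ∧ u' (OT.top n) = 0 ∨ ∃ a ∈ F, u' (OT.top n) = t' a) := by
  classical
  induction n with
  | zero =>
    intro F hF t ht
    rw [Finset.card_eq_zero] at hF
    subst hF
    exact ⟨fun _ => (), fun K t' _ _ => ⟨fun _ => 0, rfl, by simp, Or.inl ⟨rfl, rfl⟩⟩⟩
  | succ n ih =>
    intro F hF t ht
    have hne : F.Nonempty := by rw [← Finset.card_pos]; omega
    obtain ⟨m, hm, hmax⟩ := Finset.exists_max_image F t hne
    obtain ⟨g, hg⟩ := ih (F.erase m) (by rw [Finset.card_erase_of_mem hm]; omega) t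
      (fun a ha => ⟨(ht a (Finset.mem_of_mem_erase ha)).1, fun b hb =>
        (ht a (Finset.mem_of_mem_erase ha)).2 b (Finset.mem_of_mem_erase hb)⟩)
    refine ⟨fun a => if a = m then none else some (g a), fun K t' ht' hpat => ?_⟩
    obtain ⟨u, hu, hug, hut⟩ := hg K t'
      (fun a ha => ⟨(ht' a (Finset.mem_of_mem_erase ha)).1, fun b hb =>
        (ht' a (Finset.mem_of_mem_erase ha)).2 b (Finset.mem_of_mem_erase hb)⟩)
      (fun a ha b hb => hpat a (Finset.mem_of_mem_erase ha) b (Finset.mem_of_mem_erase hb))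
    refine ⟨ext u (t' m), ⟨hu, ?_⟩, ?_, Or.inr ⟨m, hm, rfl⟩⟩
    · show u (OT.top n) + K ≤ t' m
      rcases hut with ⟨-, h0⟩ | ⟨a, ha, h0⟩
      · rw [h0]; have := (ht' m hm).1; omega
      · rw [h0]
        have ha' := Finset.mem_of_mem_erase ha
        have hne := Finset.ne_of_mem_erase ha
        have h1 := (ht a ha').2 m hm hne
        have h2 := hmax a ha'
        have h3 : t a < t m := by omega
        have h4 := (hpat a ha' m hm).1 h3
        have h5 := (ht' a ha').2 m hm hne
        omega
    · intro a ha
      by_cases h : a = m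
      · subst h; simp
      · simp only [h, if_false, ext_some]
        exact hug a (Finset.mem_erase.2 ⟨h, ha⟩)

theorem pattern (h : OSeq L D lt c)
    (hs : ∀ R : (Unit → ℕ) → Prop, Tr L c R → ∃ K : ℕ, ∃ v : Prop, ∀ u, K ≤ u () → (R u ↔ v))
    {α : Type*} {R : (α → ℕ) → Prop} (hR : Tr L c R) :
    ∃ F₀ : Finset α, ∀ F, F₀ ⊆ F → ∃ K : ℕ, ∀ t t', Sep K F t → Sep K F t' →
      (∀ a ∈ F, ∀ b ∈ F, t a < t b ↔ t' a < t' b) → (R t ↔ R t') := by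
  classical
  obtain ⟨F₀, hF₀⟩ := hR.finsupp
  refine ⟨F₀, fun F hF => ?_⟩
  have h1 : ∀ pat : F → F → Prop, ∃ K : ℕ, ∀ t t', Sep K F t → Sep K F t' →
      (∀ a b : F, t a < t b ↔ pat a b) → (∀ a b : F, t' a < t' b ↔ pat a b) → (R t ↔ R t') := by
    intro pat
    by_cases hc : ∃ t, Sep 0 F t ∧ (∀ a b : F, t a < t b ↔ pat a b)
    · obtain ⟨t₀, ht₀, hp₀⟩ := hc
      obtain ⟨g, hg⟩ := sort_sep F.card F rfl t₀ ht₀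
      obtain ⟨K, v, hv⟩ := cst_all h hs F.card _ (hR.sub g)
      have key : ∀ t, Sep K F t → (∀ a b : F, t a < t b ↔ pat a b) → (R t ↔ v) := by
        intro t ht hp
        obtain ⟨u, hu, hug, -⟩ := hg K t ht (fun a ha b hb =>
          (hp₀ ⟨a, ha⟩ ⟨b, hb⟩).trans (hp ⟨a, ha⟩ ⟨b, hb⟩).symm)
        rw [← hv u hu]
        exact hF₀ _ _ fun a ha => hug a (hF ha)
      exact ⟨K, fun t t' ht ht' hp hp' => (key t ht hp).trans (key t' ht' hp').symm⟩
    · refine ⟨0, fun t t' ht ht' hp hp' => (hc ⟨t, ht, hp⟩).elim⟩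
  choose K hK using h1
  refine ⟨Finset.univ.sup K, fun t t' ht ht' hp => ?_⟩
  have hle : K (fun a b : F => t a < t b) ≤ Finset.univ.sup K := Finset.le_sup (Finset.mem_univ _)
  have hm : ∀ s, Sep (Finset.univ.sup K) F s → Sep (K (fun a b : F => t a < t b)) F s := by
    intro s hs a ha
    refine ⟨hle.trans (hs a ha).1, fun b hb hab => ?_⟩
    rcases (hs a ha).2 b hb hab with h | h
    · left; omega
    · right; omega
  exact hK (fun a b : F => t a < t b) t t' (hm t ht) (hm t' ht') (fun _ _ => Iff.rfl)
    (fun a b => (hp a a.2 b b.2).symm)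

end
end DiscMod

namespace DiscMod

section
variable {L : FirstOrder.Language.{u, v}} {M : Type w} [L.Structure M] {D : M → Prop}
    {lt : M → M → Prop} {c : ℕ → M}

/-- distance at most `k` -/
def Dst (lt : M → M → Prop) : ℕ → M → M → Prop
  | 0 => fun x y => x = y
  | k + 1 => fun x y => ∃ z, Dst lt k x z ∧ (z = y ∨ Cov lt z y ∨ Cov lt y z)

theorem OSeq.dDst (h : OSeq L D lt c) {α : Type*} (k : ℕ) (i j : α) :
    Dfn L (fun x : α → M => Dst lt k (x i) (x j)) := by
  induction k generalizing α with
  | zero => exact Dfn.eq i j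
  | succ k ih =>
    refine Dfn.ex (R := fun x z => Dst lt k (x i) z ∧ (z = x j ∨ Cov lt z (x j) ∨ Cov lt (x j) z)) ?_
    exact (ih (some i) none).and ((Dfn.eq _ _).or ((h.dcov _ _).or (h.dcov _ _)))

theorem OSeq.dst_right (h : OSeq L D lt c) (k : ℕ) (i : ℕ) (x : M) :
    Dst lt k (c i) x ↔ ∃ j, x = c j ∧ i ≤ j + k ∧ j ≤ i + k := by
  induction k generalizing x with
  | zero =>
    constructor
    · intro e; exact ⟨i, e.symm, by omega, by omega⟩
    · rintro ⟨j, rfl, h1, h2⟩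
      show c i = c j
      congr 1; omega
  | succ k ih =>
    constructor
    · rintro ⟨z, hz, h1⟩
      obtain ⟨j, rfl, h2, h3⟩ := (ih _).1 hz
      rcases h1 with rfl | h1 | h1
      · exact ⟨j, rfl, by omega, by omega⟩
      · exact ⟨j + 1, h.cov_iff.1 h1, by omega, by omega⟩
      · obtain ⟨m, rfl, rfl⟩ := h.cov_iff'.1 h1
        exact ⟨m, rfl, by omega, by omega⟩
    · rintro ⟨j, rfl, h1, h2⟩
      by_cases h3 : i ≤ j + k
      · by_cases h4 : j ≤ i + k
        · exact ⟨c j, (ih _).2 ⟨j, rfl, h3, h4⟩, Or.inl rfl⟩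
        · obtain ⟨m, rfl⟩ : ∃ m, j = m + 1 := ⟨j - 1, by omega⟩
          exact ⟨c m, (ih _).2 ⟨m, rfl, by omega, by omega⟩, Or.inr (Or.inl (h.cov_iff.2 rfl))⟩
      · exact ⟨c (j + 1), (ih _).2 ⟨j + 1, rfl, by omega, by omega⟩,
          Or.inr (Or.inr (h.cov_iff.2 rfl))⟩

theorem OSeq.dst_left (h : OSeq L D lt c) (k : ℕ) (j : ℕ) (x : M) (hx : Dst lt k x (c j)) :
    ∃ i, x = c i ∧ i ≤ j + k ∧ j ≤ i + k := by
  induction k generalizing j with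
  | zero => exact ⟨j, hx, by omega, by omega⟩
  | succ k ih =>
    obtain ⟨z, hz, h1⟩ := hx
    rcases h1 with rfl | h1 | h1
    · obtain ⟨i, rfl, h2, h3⟩ := ih _ hz
      exact ⟨i, rfl, by omega, by omega⟩
    · obtain ⟨m, rfl, rfl⟩ := h.cov_iff'.1 h1
      obtain ⟨i, rfl, h2, h3⟩ := ih _ hz
      exact ⟨i, rfl, by omega, by omega⟩
    · obtain rfl := h.cov_iff.1 h1
      obtain ⟨i, rfl, h2, h3⟩ := ih _ hz
      exact ⟨i, rfl, by omega, by omega⟩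

theorem OSeq.dltc (h : OSeq L D lt c) {α : Type*} (i : α) (m : ℕ) :
    Dfn L (fun x : α → M => lt (x i) (c m)) := by
  have h1 : Dfn L (fun x : α → M => ∃ w, w = c m ∧ lt (x i) w) :=
    Dfn.ex (R := fun x w => w = c m ∧ lt (x i) w) ((h.deqc none m).and (h.dlt' (some i) none))
  exact h1.congr fun x => by simp

/-- spread tuples indexed by a linear order -/
def Spr {X : Type} [LinearOrder X] (K : ℕ) (F : Finset X) (i : X → ℕ) : Prop :=
  ∀ q ∈ F, K ≤ i q ∧ ∀ q' ∈ F, q < q' → i q + K < i q'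

theorem Spr.exists {X : Type} [LinearOrder X] (K : ℕ) (F : Finset X) : ∃ i, Spr K F i := by
  refine ⟨fun q => (K + 1) * ((F.filter (· < q)).card + 1), fun q hq => ⟨?_, fun q' hq' hl => ?_⟩⟩
  · nlinarith [Nat.zero_le (K * (F.filter (· < q)).card)]
  · have : (F.filter (· < q)).card < (F.filter (· < q')).card := by
      refine Finset.card_lt_card ⟨fun x hx => ?_, fun hx => ?_⟩
      · simp only [Finset.mem_filter] at hx ⊢
        exact ⟨hx.1, hx.2.trans hl⟩
      · have := hx (show q ∈ F.filter (· < q') by simp [hq, hl])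
        simp at this
    nlinarith

theorem Spr.mono {X : Type} [LinearOrder X] {K K' : ℕ} {F F' : Finset X} {i : X → ℕ}
    (h : Spr K' F' i) (hK : K ≤ K') (hF : F ⊆ F') : Spr K F i := fun q hq =>
  ⟨hK.trans (h q (hF hq)).1, fun q' hq' hl => by have := (h q (hF hq)).2 q' (hF hq') hl; omega⟩

theorem Spr.lt_iff {X : Type} [LinearOrder X] {K : ℕ} {F : Finset X} {i : X → ℕ}
    (h : Spr K F i) {q q' : X} (hq : q ∈ F) (hq' : q' ∈ F) : i q < i q' ↔ q < q' := by
  rcases lt_trichotomy q q' with h1 | h1 | h1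
  · have := (h q hq).2 q' hq' h1
    simp only [h1, iff_true]; omega
  · subst h1; simp
  · have := (h q' hq').2 q hq h1
    simp only [h1.not_gt, iff_false]; omega

theorem Spr.sep {X : Type} [LinearOrder X] {K : ℕ} {F : Finset X} {i : X → ℕ} {j : ℕ}
    (h : Spr K F i) (hj : K ≤ j) (hs : ∀ q ∈ F, i q + K < j ∨ j + K < i q) :
    Sep K (Finset.insertNone F) (ext i j) := by
  rintro (_ | a) ha
  · refine ⟨hj, ?_⟩
    rintro (_ | b) hb hab
    · exact (hab rfl).elim
    · exact (hs b (by simpa using hb)).symm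
  · have ha' : a ∈ F := by simpa using ha
    refine ⟨(h a ha').1, ?_⟩
    rintro (_ | b) hb hab
    · exact hs a ha'
    · have hb' : b ∈ F := by simpa using hb
      rcases lt_trichotomy a b with h1 | h1 | h1
      · exact Or.inl ((h a ha').2 b hb' h1)
      · exact (hab (by rw [h1])).elim
      · exact Or.inr ((h b hb').2 a ha' h1)

def OO (c : ℕ → M) (dst : ℕ → L.Formula (Fin 2)) (X : Type) : Set (L.Formula (Option X)) :=
  {o | (∃ χ : L.Formula Unit, (∃ m, ∀ i, m ≤ i → χ.Realize (fun _ => c i)) ∧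
      o = (Formula.not χ).relabel (fun _ => none)) ∨
    ∃ (k : ℕ) (q : X), o = (dst k).relabel ![some q, none]}

theorem real_chi {N : Type*} [L.Structure N] {X : Type} (χ : L.Formula Unit) (y : X → N) (x : N) :
    ((Formula.not χ).relabel (fun _ => none) : L.Formula (Option X)).Realize (ext y x) ↔
      ¬ χ.Realize (fun _ => x) := by
  rw [Formula.realize_relabel, Formula.realize_not]; rfl

theorem real_dst {N : Type*} [L.Structure N] {X : Type} (φ : L.Formula (Fin 2)) (q : X) (y : X → N)
    (x : N) : (φ.relabel ![some q, none] : L.Formula (Option X)).Realize (ext y x) ↔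
      φ.Realize ![y q, x] := by
  rw [Formula.realize_relabel]
  have : ext y x ∘ ![some q, none] = ![y q, x] := by
    funext i; fin_cases i <;> rfl
  rw [this]

theorem dens (h : OSeq L D lt c)
    (hs : ∀ R : (Unit → ℕ) → Prop, Tr L c R → ∃ K : ℕ, ∃ v : Prop, ∀ u, K ≤ u () → (R u ↔ v))
    (dst : ℕ → L.Formula (Fin 2)) (hdst : ∀ k x y, (dst k).Realize ![x, y] ↔ Dst lt k x y)
    {X : Type} [LinearOrder X] (ρ : L.Formula (Option X)) :
    ∃ K F, ∃ Os : Set (L.Formula (Option X)), Os.Finite ∧ Os ⊆ OO c dst X ∧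
      ∀ i, Spr K F i → (∃ x, ρ.Realize (ext (fun q => c (i q)) x)) →
        ∃ o ∈ Os, ∃ x, ρ.Realize (ext (fun q => c (i q)) x) ∧
          o.Realize (ext (fun q => c (i q)) x) := by
  classical
  obtain ⟨F₀, hpat⟩ := pattern h hs (Tr.of (c := c) (Dfn.of (M := M) ρ))
  obtain ⟨F₁, hfs⟩ := (Dfn.of (M := M) ρ).finsupp
  obtain ⟨F, hF⟩ : ∃ F : Finset X, F₀ ∪ F₁ ⊆ Finset.insertNone F := by
    refine ⟨Finset.eraseNone (F₀ ∪ F₁), ?_⟩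
    rintro (_ | a) ha
    · simp
    · simpa using ha
  obtain ⟨K, hK⟩ := hpat (Finset.insertNone F) (Finset.union_subset_left hF)
  have hcx : ∀ (i : X → ℕ) (j : ℕ), (fun a => c (ext i j a)) = ext (fun q => c (i q)) (c j) := by
    intro i j; funext a; cases a <;> rfl
  by_cases hT : ∃ i' j', Spr K F i' ∧ K ≤ j' ∧ (∀ q ∈ F, i' q + K < j' ∨ j' + K < i' q) ∧
      ρ.Realize (ext (fun q => c (i' q)) (c j'))
  · obtain ⟨i', j', hi', hj', hsep', hρ'⟩ := hT
    have key : ∀ i j, Spr K F i → K ≤ j → (∀ q ∈ F, i q + K < j ∨ j + K < i q) →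
        (∀ q ∈ F, i q < j ↔ i' q < j') → ρ.Realize (ext (fun q => c (i q)) (c j)) := by
      intro i j hi hj hsep hp
      have := hK (ext i j) (ext i' j') (hi.sep hj hsep) (hi'.sep hj' hsep') (by
        rintro (_ | a) ha (_ | b) hb
        · simp
        · have hb' : b ∈ F := by simpa using hb
          have h1 := hp b hb'
          have h2 := hsep b hb'
          have h3 := hsep' b hb'
          simp only [ext_none, ext_some]
          omega
        · exact hp a (by simpa using ha)
        · have hb' : b ∈ F := by simpa using hb
          have ha' : a ∈ F := by simpa using ha
          simp only [ext_some]
          rw [hi.lt_iff ha' hb', hi'.lt_iff ha' hb'])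
      rw [hcx, hcx] at this
      exact this.2 hρ'
    by_cases hG : (F.filter (fun q => i' q < j')).Nonempty
    · obtain ⟨q, hq, hmax⟩ := Finset.exists_max_image _ id hG
      rw [Finset.mem_filter] at hq
      refine ⟨2 * K + 3, F, {(dst (K+1)).relabel ![some q, none]}, Set.finite_singleton _,
        ?_, fun i hi _ => ⟨_, rfl, c (i q + K + 1), ?_, ?_⟩⟩
      · rintro _ rfl
        exact Or.inr ⟨_, _, rfl⟩
      · have hq1 := (hi q hq.1).1
        have hd : ∀ r ∈ F, (r ≤ q ∧ i r ≤ i q ∧ i' r < j') ∨ (i q + 2 * K + 3 < i r ∧ ¬ i' r < j') := by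
          intro r hr
          rcases le_or_gt r q with h1 | h1
          · left
            refine ⟨h1, ?_, ?_⟩
            · have := hi.lt_iff hq.1 hr
              have := h1.not_gt
              by_contra; simp_all
            · have h2 := hi'.lt_iff hq.1 hr
              have := h1.not_gt
              have h3 : ¬ i' q < i' r := by rw [h2]; exact this
              omega
          · right
            refine ⟨by have := (hi q hq.1).2 r hr h1; omega, fun hcon => ?_⟩
            exact h1.not_ge (hmax r (Finset.mem_filter.2 ⟨hr, hcon⟩))
        refine key _ _ (hi.mono (by omega) le_rfl) (by omega) (fun r hr => ?_) (fun r hr => ?_)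
        · by_cases hrq : r = q
          · subst hrq; left; omega
          rcases hd r hr with ⟨h1, h2, h3⟩ | ⟨h1, h2⟩
          · left; omega
          · right; omega
        · rcases hd r hr with ⟨h1, h2, h3⟩ | ⟨h1, h2⟩
          · simp only [h3, iff_true]; omega
          · simp only [h2, iff_false]; omega
      · rw [real_dst, hdst, h.dst_right]
        exact ⟨_, rfl, by omega, by omega⟩
    · obtain ⟨ψ, hψ⟩ := h.deqc (α := Unit) () K
      refine ⟨2 * K + 3, F, {(Formula.not (Formula.not ψ)).relabel (fun _ => none)},
        Set.finite_singleton _, ?_, fun i hi _ => ⟨_, rfl, c K, ?_, ?_⟩⟩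
      · rintro _ rfl
        refine Or.inl ⟨_, ⟨K + 1, fun i hi => ?_⟩, rfl⟩
        rw [Formula.realize_not, hψ]
        intro e
        have := h.inj e
        omega
      · refine key _ _ (hi.mono (by omega) le_rfl) le_rfl (fun r hr => ?_) (fun r hr => ?_)
        · have := (hi r hr).1; right; omega
        · have h1 : ¬ i' r < j' := fun hcon => hG ⟨r, Finset.mem_filter.2 ⟨hr, hcon⟩⟩
          have := (hi r hr).1
          simp only [h1, iff_false]; omega
      · rw [real_chi, Formula.realize_not, hψ, not_not]
  · have hFc : ∀ i' j', Spr K F i' → ρ.Realize (ext (fun q => c (i' q)) (c j')) →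
        j' < K ∨ ∃ q ∈ F, i' q ≤ j' + K ∧ j' ≤ i' q + K := by
      intro i' j' hi' hρ
      by_contra hcon
      push Not at hcon
      refine hT ⟨i', j', hi', hcon.1, fun q hq => ?_, hρ⟩
      have := hcon.2 q hq
      omega
    let Chi : M → Prop := fun z => ∀ e : Option X → M,
      ((∀ o : Finset.insertNone F, e o = z ∨ lt (e o) z) ∧ (∀ q : F, ¬ lt (e (some q)) (c K)) ∧
      (∀ q : {q : F × F // q.1 < q.2}, lt (e (some q.1.1)) (e (some q.1.2)) ∧
        ¬ Dst lt K (e (some q.1.1)) (e (some q.1.2))) ∧ ρ.Realize e) →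
      (lt (e none) (c K) ∨ ∃ q : F, Dst lt K (e (some q)) (e none))
    have : Nonempty M := ⟨c 0⟩
    have hChi : Dfn L (fun x : Unit → M => Chi (x ())) := by
      have h1 : Dfn L (fun x : Unit ⊕ Option X → M =>
        ((∀ o : Finset.insertNone F, x (Sum.inr o) = x (Sum.inl ()) ∨
            lt (x (Sum.inr o)) (x (Sum.inl ()))) ∧
          (∀ q : F, ¬ lt (x (Sum.inr (some q))) (c K)) ∧
          (∀ q : {q : F × F // q.1 < q.2}, lt (x (Sum.inr (some q.1.1))) (x (Sum.inr (some q.1.2))) ∧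
            ¬ Dst lt K (x (Sum.inr (some q.1.1))) (x (Sum.inr (some q.1.2)))) ∧
          ρ.Realize (fun o => x (Sum.inr o))) →
        (lt (x (Sum.inr none)) (c K) ∨ ∃ q : F, Dst lt K (x (Sum.inr (some q))) (x (Sum.inr none)))) := by
        refine Dfn.imp ((Dfn.bAll fun o => (Dfn.eq _ _).or (h.dlt' _ _)).and
          ((Dfn.bAll fun q => (h.dltc _ _).not).and ((Dfn.bAll fun q => (h.dlt' _ _).and
            (h.dDst _ _ _).not).and ((Dfn.of ρ).sub _))))
          ((h.dltc _ _).or (Dfn.bEx fun q => h.dDst _ _ _))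
      exact h1.alls
    obtain ⟨χ, hχ⟩ := hChi
    have hC : ∀ m, Chi (c m) := by
      rintro m e ⟨h1, h2, h3, h4⟩
      have h5 : ∀ o, ∃ j, o ∈ Finset.insertNone F → e o = c j := by
        intro o
        by_cases ho : o ∈ Finset.insertNone F
        · rcases h1 ⟨o, ho⟩ with h6 | h6
          · exact ⟨m, fun _ => h6⟩
          · obtain ⟨j, hj⟩ := h.ini _ _ h6
            exact ⟨j, fun _ => hj.symm⟩
        · exact ⟨0, fun h => (ho h).elim⟩
      choose i hi using h5
      have hi' : ∀ q ∈ F, e (some q) = c (i (some q)) := fun q hq => hi _ (by simpa using hq)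
      have hin : e none = c (i none) := hi _ (by simp)
      have hspr : Spr K F (fun q => i (some q)) := by
        intro q hq
        have h7 := h2 ⟨q, hq⟩
        rw [hi' q hq, h.clt_iff] at h7
        beta_reduce
        refine ⟨by omega, fun q' hq' hl => ?_⟩
        have h8 := h3 ⟨(⟨q, hq⟩, ⟨q', hq'⟩), hl⟩
        simp only [hi' q hq, hi' q' hq', h.clt_iff, h.dst_right] at h8
        by_contra hcon
        exact h8.2 ⟨_, rfl, by omega, by omega⟩
      have h9 := (hfs e (ext (fun q => c (i (some q))) (c (i none))) (by
        rintro (_ | a) ha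
        · exact hin
        · exact hi _ (hF (Finset.mem_union_right _ ha)))).1 h4
      rcases hFc _ _ hspr h9 with h10 | ⟨q, hq, h10, h11⟩
      · left; rw [hin]; exact h.clt _ _ h10
      · right
        refine ⟨⟨q, hq⟩, ?_⟩
        rw [hin, hi' q hq, h.dst_right]
        exact ⟨_, rfl, h10, h11⟩
    obtain ⟨δ, hδ⟩ := h.dD
    choose ψ hψ using fun m => h.deqc (α := Unit) () m
    refine ⟨K, F, ({(Formula.not δ).relabel (fun _ => none), (Formula.not χ).relabel (fun _ => none)} ∪
        (Set.image (fun q => (dst K).relabel ![some q, none]) (F : Set X))) ∪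
        (Set.image (fun m => (Formula.not (Formula.not (ψ m))).relabel (fun _ => none)) (Set.Iio K)),
        ?_, ?_, ?_⟩
    · exact ((Set.toFinite _).union (F.finite_toSet.image _)).union ((Set.finite_Iio K).image _)
    · rintro o (((rfl | rfl) | ⟨q, hq, rfl⟩) | ⟨m, hm, rfl⟩)
      · exact Or.inl ⟨_, ⟨0, fun i _ => (hδ _).2 (h.cD i)⟩, rfl⟩
      · exact Or.inl ⟨_, ⟨0, fun i _ => (hχ _).2 (hC i)⟩, rfl⟩
      · exact Or.inr ⟨_, _, rfl⟩
      · refine Or.inl ⟨_, ⟨m + 1, fun i hi => ?_⟩, rfl⟩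
        rw [Formula.realize_not, hψ]
        intro e
        have := h.inj e
        omega
    · rintro i hi ⟨x, hx⟩
      by_cases hDx : D x
      · by_cases hCx : ∃ j, x = c j
        · obtain ⟨j, rfl⟩ := hCx
          rcases hFc _ _ hi hx with h10 | ⟨q, hq, h10, h11⟩
          · refine ⟨_, Or.inr ⟨j, h10, rfl⟩, c j, hx, ?_⟩
            rw [real_chi, Formula.realize_not, hψ, not_not]
          · refine ⟨_, Or.inl (Or.inr ⟨q, hq, rfl⟩), c j, hx, ?_⟩
            simp only
            rw [real_dst, hdst, h.dst_right]
            exact ⟨_, rfl, h10, h11⟩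
        · refine ⟨_, Or.inl (Or.inl (Or.inr rfl)), x, hx, ?_⟩
          rw [real_chi, hχ]
          intro hcon
          have hlt : ∀ j, lt (c j) x := by
            intro j
            rcases h.tot _ _ (h.cD j) hDx with e | e | e
            · exact (hCx ⟨j, e.symm⟩).elim
            · exact e
            · obtain ⟨j', hj'⟩ := h.ini _ _ e
              exact (hCx ⟨j', hj'.symm⟩).elim
          have hres := hcon (ext (fun q => c (i q)) x)
          specialize hres ⟨?_, ?_, ?_, hx⟩
          · rintro ⟨_ | a, ha⟩
            · left; rfl
            · right; exact hlt _
          · intro q hcon2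
            have h2 := (h.clt_iff (i := i q) (j := K)).1 hcon2
            have := (hi q q.2).1
            omega
          · rintro ⟨⟨q, q'⟩, hl⟩
            have h2 := (hi q q.2).2 q' q'.2 hl
            refine ⟨h.clt _ _ (by simp only; omega), fun hcon2 => ?_⟩
            obtain ⟨j, hj, h3, h4⟩ := (h.dst_right _ _ _).1 hcon2
            have h5 := h.inj hj
            simp only at h3 h4 h5
            omega
          · rcases hres with h1 | ⟨q, h1⟩
            · exact h.asymm h1 (hlt K)
            · obtain ⟨j, hj, -⟩ := (h.dst_right _ _ _).1 h1
              exact hCx ⟨j, hj⟩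
      · refine ⟨_, Or.inl (Or.inl (Or.inl rfl)), x, hx, ?_⟩
        rw [real_chi, hδ]
        exact hDx

end
end DiscMod

namespace DiscMod

section
variable {L : FirstOrder.Language.{u, v}} {M : Type w} [L.Structure M] {D : M → Prop}
    {lt : M → M → Prop} {c : ℕ → M}

/-- the countable structure `S` is the model attached to the linear order `X` -/
structure IsMod (c : ℕ → M) (dst : ℕ → L.Formula (Fin 2)) (X : Type) [LinearOrder X]
    (N : Type) [L.Structure N] (a : X → N) : Prop where
  tru : ∀ φ : L.Formula X, (∃ K F, ∀ i, Spr K F i → φ.Realize (fun q => c (i q))) → φ.Realize a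
  omt : ∀ b : N, (∃ χ : L.Formula Unit, (∃ m, ∀ i, m ≤ i → χ.Realize (fun _ => c i)) ∧
    ¬ χ.Realize (fun _ => b)) ∨ ∃ k q, (dst k).Realize ![a q, b]

theorem exists_mod (hL : L.card ≤ ℵ₀) (h : OSeq L D lt c)
    (hs : ∀ R : (Unit → ℕ) → Prop, Tr L c R → ∃ K : ℕ, ∃ v : Prop, ∀ u, K ≤ u () → (R u ↔ v))
    (dst : ℕ → L.Formula (Fin 2)) (hdst : ∀ k x y, (dst k).Realize ![x, y] ↔ Dst lt k x y)
    (X : Type) [LinearOrder X] [Countable X] :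
    ∃ (S : L.Structure ℕ) (a : X → ℕ), IsMod c dst X ℕ a := by
  have : Nonempty M := ⟨c 0⟩
  obtain ⟨en, hen⟩ := exists_injective_nat X
  have hfin : ∀ n : ℕ, {x : X | en x < n}.Finite := fun n =>
    Set.Finite.preimage hen.injOn (Set.finite_Iio n)
  choose ii hii using fun n : ℕ => Spr.exists n (hfin n).toFinset
  let U : Ultrafilter ℕ := Filter.hyperfilter ℕ
  have hUge : ∀ m, ∀ᶠ n in (U : Filter ℕ), m ≤ n := by
    intro m
    have : (Filter.hyperfilter ℕ : Filter ℕ) ≤ Filter.atTop := by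
      rw [← Nat.cofinite_eq_atTop]; exact Filter.hyperfilter_le_cofinite
    exact this (Filter.eventually_ge_atTop m)
  have hspr : ∀ K F, ∀ᶠ n in (U : Filter ℕ), Spr K F (ii n) := by
    intro K F
    filter_upwards [hUge K, hUge (F.sup en + 1)] with n h1 h2
    refine (hii n).mono h1 fun x hx => ?_
    have : en x ≤ F.sup en := Finset.le_sup hx
    simp only [Set.Finite.mem_toFinset, Set.mem_setOf_eq]
    omega
  let P := (U : Filter ℕ).Product (fun _ => M)
  let mk : (ℕ → M) → P := fun x => (x : (U : Filter ℕ).Product (fun _ => M))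
  have los : ∀ {β : Type} (φ : L.Formula β) (x : β → ℕ → M),
      φ.Realize (fun i => mk (x i)) ↔ ∀ᶠ n in (U : Filter ℕ), φ.Realize fun i => x i n :=
    fun φ x => Ultraproduct.realize_formula_cast φ x
  let A : X → P := fun q => mk (fun n => c (ii n q))
  have key : ∀ (ρ : L.Formula (Option X)) (z : ℕ → M), ρ.Realize (ext A (mk z)) ↔
      ∀ᶠ n in (U : Filter ℕ), ρ.Realize (ext (fun q => c (ii n q)) (z n)) := by
    intro ρ z
    have := los ρ (ext (fun q n => c (ii n q)) z)
    convert this using 2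
    · funext i
      rcases i with _ | i <;> rfl
    · funext n
      congr 1
      funext i
      rcases i with _ | i <;> rfl
  have hPM : P ≅[L] M := by
    rw [elementarilyEquivalent_iff]
    intro φ
    have := Ultraproduct.sentence_realize (M := fun _ : ℕ => M) (u := U) φ
    refine this.trans ?_
    simp
  have : Infinite M := Infinite.of_injective c fun i j e => h.inj e
  have : Infinite P := hPM.symm.infinite
  have : Nonempty M := ⟨c 0⟩
  obtain ⟨S, a, ha, hb⟩ := omitting hL A (OO c dst X) (by
    rintro R ⟨ρ, hρ⟩ ⟨x, hx⟩
    obtain ⟨z, rfl⟩ : ∃ z, mk z = x := Quotient.exists_rep x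
    rw [← hρ, key] at hx
    obtain ⟨K, F, Os, hfin, hsub, hO⟩ := dens h hs dst hdst ρ
    have h1 : ∀ᶠ n in (U : Filter ℕ), ∃ o ∈ Os, ∃ x, ρ.Realize (ext (fun q => c (ii n q)) x) ∧
          o.Realize (ext (fun q => c (ii n q)) x) := by
      filter_upwards [hspr K F, hx] with n h1 h2
      exact hO _ h1 ⟨_, h2⟩
    rw [Ultrafilter.eventually_exists_mem_iff hfin] at h1
    obtain ⟨o, ho, h2⟩ := h1
    obtain ⟨z', hz'⟩ := h2.choice
    refine ⟨o, hsub ho, mk z', ?_, ?_⟩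
    · rw [← hρ, key]
      exact hz'.mono fun n hn => hn.1
    · rw [key]
      exact hz'.mono fun n hn => hn.2)
  refine ⟨S, a, fun φ hφ => ?_, fun b => ?_⟩
  · obtain ⟨K, F, hKF⟩ := hφ
    rw [ha]
    refine (los φ (fun q n => c (ii n q))).2 ?_
    filter_upwards [hspr K F] with n hn
    exact hKF _ hn
  · obtain ⟨o, ho, hob⟩ := hb b
    rcases ho with ⟨χ, hχ, rfl⟩ | ⟨k, q, rfl⟩
    · exact Or.inl ⟨χ, hχ, (real_chi _ _ _).1 hob⟩
    · exact Or.inr ⟨k, q, (real_dst _ _ _ _).1 hob⟩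

theorem IsMod.elem {dst : ℕ → L.Formula (Fin 2)} {X : Type} [LinearOrder X]
    {N : Type} [L.Structure N] {a : X → N} (h : IsMod c dst X N a) (φ : L.Sentence) (hφ : M ⊨ φ) :
    N ⊨ φ := by
  have h1 := h.tru (Formula.relabel (Empty.elim : Empty → X) φ) ⟨0, ∅, fun i _ => by
    rw [Formula.realize_relabel]
    have : (fun q => c (i q)) ∘ (Empty.elim : Empty → X) = default := Subsingleton.elim _ _
    rw [this]; exact hφ⟩
  rw [Formula.realize_relabel] at h1
  have : a ∘ (Empty.elim : Empty → X) = default := Subsingleton.elim _ _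
  rw [this] at h1
  exact h1

/-- binary formulas true on sufficiently spread pairs -/
theorem IsMod.two {dst : ℕ → L.Formula (Fin 2)} {X : Type} [LinearOrder X]
    {N : Type} [L.Structure N] {a : X → N} (h : IsMod c dst X N a) (φ : L.Formula (Fin 2)) (q q' : X)
    (K : ℕ) (hφ : ∀ i j : ℕ, (q < q' → i + K < j) → (q' < q → j + K < i) → (q = q' → i = j) →
      φ.Realize ![c i, c j]) : φ.Realize ![a q, a q'] := by
  classical
  have h1 := h.tru (φ.relabel ![q, q']) ⟨K, {q, q'}, fun i hi => by
    rw [Formula.realize_relabel]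
    have : (fun q => c (i q)) ∘ ![q, q'] = ![c (i q), c (i q')] := by
      funext x; fin_cases x <;> rfl
    rw [this]
    refine hφ _ _ (fun hl => (hi q (by simp)).2 q' (by simp) hl)
      (fun hl => (hi q' (by simp)).2 q (by simp) hl) (fun e => by rw [e])⟩
  rw [Formula.realize_relabel] at h1
  have : a ∘ ![q, q'] = ![a q, a q'] := by
      funext x; fin_cases x <;> rfl
  rwa [this] at h1

theorem IsMod.one {dst : ℕ → L.Formula (Fin 2)} {X : Type} [LinearOrder X]
    {N : Type} [L.Structure N] {a : X → N} (h : IsMod c dst X N a) (χ : L.Formula Unit) (q : X)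
    (hχ : ∃ m, ∀ i, m ≤ i → χ.Realize (fun _ => c i)) : χ.Realize (fun _ => a q) := by
  obtain ⟨m, hm⟩ := hχ
  have h1 := h.tru (χ.relabel (fun _ => q)) ⟨m, {q}, fun i hi => by
    rw [Formula.realize_relabel]
    exact hm _ (hi q (by simp)).1⟩
  rw [Formula.realize_relabel] at h1
  exact h1

/-- points near the two arguments are ordered -/
noncomputable def fW (d d' l : L.Formula (Fin 2)) : L.Formula (Fin 2) :=
  Formula.iAlls (Fin 2) ((Formula.relabel ![Sum.inr 0, Sum.inl 0] d ⊓
    Formula.relabel ![Sum.inr 1, Sum.inl 1] d').imp (Formula.relabel ![Sum.inr 0, Sum.inr 1] l) :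
      L.Formula (Fin 2 ⊕ Fin 2))

theorem real_fW {N : Type*} [L.Structure N] (d d' l : L.Formula (Fin 2)) (x y : N) :
    (fW d d' l).Realize ![x, y] ↔ ∀ p p' : N, d.Realize ![p, x] → d'.Realize ![p', y] →
      l.Realize ![p, p'] := by
  have h0 : ∀ (e : Fin 2 → N) (g : Fin 2 → Fin 2 ⊕ Fin 2),
      (fun i => Sum.elim ![x, y] e i) ∘ g = ![Sum.elim ![x, y] e (g 0), Sum.elim ![x, y] e (g 1)] := by
    intro e g; funext i; fin_cases i <;> rfl
  have h1 : ∀ e : Fin 2 → N, Sum.elim ![x, y] e = fun i => Sum.elim ![x, y] e i := fun _ => rfl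
  unfold fW
  rw [Formula.realize_iAlls]
  simp only [Formula.realize_imp, Formula.realize_inf, Formula.realize_relabel, h0]
  constructor
  · intro h p p' h1 h2
    exact h ![p, p'] ⟨h1, h2⟩
  · intro h e he
    exact h _ _ he.1 he.2

/-- no common nearby point -/
noncomputable def fV (d d' : L.Formula (Fin 2)) : L.Formula (Fin 2) :=
  Formula.not (Formula.iExs Unit (Formula.relabel ![Sum.inl 0, Sum.inr ()] d ⊓
    Formula.relabel ![Sum.inr (), Sum.inl 1] d' : L.Formula (Fin 2 ⊕ Unit)))

theorem real_fV {N : Type*} [L.Structure N] (d d' : L.Formula (Fin 2)) (x y : N) :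
    (fV d d').Realize ![x, y] ↔ ¬ ∃ z : N, d.Realize ![x, z] ∧ d'.Realize ![z, y] := by
  have h0 : ∀ (e : Unit → N) (g : Fin 2 → Fin 2 ⊕ Unit),
      (fun i => Sum.elim ![x, y] e i) ∘ g = ![Sum.elim ![x, y] e (g 0), Sum.elim ![x, y] e (g 1)] := by
    intro e g; funext i; fin_cases i <;> rfl
  unfold fV
  rw [Formula.realize_not, Formula.realize_iExs]
  simp only [Formula.realize_inf, Formula.realize_relabel, h0]
  refine not_congr ⟨?_, ?_⟩
  · rintro ⟨e, he⟩
    exact ⟨e (), he⟩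
  · rintro ⟨z, hz⟩
    exact ⟨fun _ => z, hz⟩

theorem iso_order (h : OSeq L D lt c)
    (dst : ℕ → L.Formula (Fin 2)) (hdst : ∀ k x y, (dst k).Realize ![x, y] ↔ Dst lt k x y)
    {X Y : Type} [LinearOrder X] [LinearOrder Y] {N N' : Type} [L.Structure N] [L.Structure N']
    {a : X → N} {b : Y → N'}
    (hX : IsMod c dst X N a) (hY : IsMod c dst Y N' b)
    (f : N ≃[L] N') : Nonempty (X ≃o Y) := by
  obtain ⟨lF, hlF⟩ := h.dlt
  have hl : ∀ x y, lF.Realize ![x, y] ↔ lt x y := fun x y => hlF _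
  have f1 : ∀ (φ : L.Formula Unit) (x : N), φ.Realize (fun _ => f x) ↔ φ.Realize (fun _ => x) :=
    fun φ x => StrongHomClass.realize_formula f φ (v := fun _ => x)
  have f2 : ∀ (φ : L.Formula (Fin 2)) (x y : N), φ.Realize ![f x, f y] ↔ φ.Realize ![x, y] := by
    intro φ x y
    rw [← StrongHomClass.realize_formula f φ (v := ![x, y])]
    have : f ∘ ![x, y] = ![f x, f y] := by funext i; fin_cases i <;> rfl
    rw [this]
  have hF : ∀ q : X, ∃ k r, (dst k).Realize ![b r, f (a q)] := by
    intro q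
    rcases hY.omt (f (a q)) with ⟨χ, hχ, hn⟩ | hh
    · rw [f1] at hn
      exact (hn (hX.one χ q hχ)).elim
    · exact hh
  have hG : ∀ r : Y, ∃ k q, (dst k).Realize ![f (a q), b r] := by
    intro r
    obtain ⟨x, hx⟩ := f.surjective (b r)
    rcases hX.omt x with ⟨χ, hχ, hn⟩ | ⟨k, q, hh⟩
    · rw [← f1, hx] at hn
      exact (hn (hY.one χ r hχ)).elim
    · refine ⟨k, q, ?_⟩
      rw [← hx, f2]; exact hh
  choose k F hkF using hF
  have mono : StrictMono F := by
    intro q q' hq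
    have h1 : (fW (dst (k q)) (dst (k q')) lF).Realize ![a q, a q'] := by
      refine hX.two _ q q' (k q + k q') fun i j hij _ _ => ?_
      rw [real_fW]
      intro p p' hp hp'
      rw [hdst] at hp hp'
      obtain ⟨i', rfl, h2, h3⟩ := h.dst_left _ _ _ hp
      obtain ⟨j', rfl, h4, h5⟩ := h.dst_left _ _ _ hp'
      rw [hl]
      have := hij hq
      exact h.clt _ _ (by omega)
    rw [← f2, real_fW] at h1
    have h2 := h1 _ _ (hkF q) (hkF q')
    by_contra hcon
    have h3 : (Formula.not lF).Realize ![b (F q), b (F q')] := by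
      refine hY.two _ _ _ 0 fun i j h4 h5 h6 => ?_
      rw [Formula.realize_not, hl, h.clt_iff]
      rcases (not_lt.1 hcon).lt_or_eq with h7 | h7
      · have := h5 h7; omega
      · have := h6 h7.symm; omega
    rw [Formula.realize_not] at h3
    exact h3 h2
  refine ⟨StrictMono.orderIsoOfSurjective F mono fun r => ?_⟩
  obtain ⟨k', q, hq⟩ := hG r
  refine ⟨q, ?_⟩
  by_contra hne
  have h1 : (fV (dst (k q)) (dst k')).Realize ![b (F q), b r] := by
    refine hY.two _ _ _ (k q + k') fun i j h4 h5 _ => ?_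
    rw [real_fV]
    rintro ⟨z, hz, hz'⟩
    rw [hdst] at hz hz'
    obtain ⟨m, rfl, h6, h7⟩ := (h.dst_right _ _ _).1 hz
    obtain ⟨n, hn, h8, h9⟩ := (h.dst_right _ _ _).1 hz'
    have := h.inj hn
    rcases lt_or_gt_of_ne hne with hl | hl
    · have := h4 hl; omega
    · have := h5 hl; omega
  rw [real_fV] at h1
  exact h1 ⟨_, hkF q, hq⟩

end
end DiscMod

namespace DiscMod

/-- size of the chain over a rational -/
noncomputable def gsz (f : ℕ → Bool) (q : ℚ) : ℕ :=
  if f (Denumerable.eqv ℚ q) then Denumerable.eqv ℚ q + 1 else 0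

/-- countable linear order coding `f` -/
def XF (f : ℕ → Bool) : Type := {x : ℚ ×ₗ ℕ // (ofLex x).2 ≤ gsz f (ofLex x).1}

noncomputable instance (f : ℕ → Bool) : LinearOrder (XF f) :=
  inferInstanceAs (LinearOrder {x : ℚ ×ₗ ℕ // (ofLex x).2 ≤ gsz f (ofLex x).1})

instance (f : ℕ → Bool) : Countable (XF f) :=
  inferInstanceAs (Countable {x : ℚ × ℕ // x.2 ≤ gsz f x.1})

/-- constructor -/
def XF.mk {f : ℕ → Bool} (q : ℚ) (n : ℕ) (h : n ≤ gsz f q) : XF f := ⟨toLex (q, n), h⟩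

theorem XF.lt_iff {f : ℕ → Bool} {q q' : ℚ} {n n' : ℕ} {h : n ≤ gsz f q} {h' : n' ≤ gsz f q'} :
    XF.mk q n h < XF.mk q' n' h' ↔ q < q' ∨ q = q' ∧ n < n' := by
  show toLex (q, n) < toLex (q', n') ↔ _
  rw [Prod.Lex.toLex_lt_toLex]

theorem XF.cases {f : ℕ → Bool} (x : XF f) : ∃ q n, ∃ h : n ≤ gsz f q, x = XF.mk q n h :=
  ⟨(ofLex x.1).1, (ofLex x.1).2, x.2, rfl⟩

theorem XF.inj {f : ℕ → Bool} {q q' : ℚ} {n n' : ℕ} {h : n ≤ gsz f q} {h' : n' ≤ gsz f q'}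
    (e : XF.mk q n h = XF.mk q' n' h') : q = q' ∧ n = n' := by
  have h1 : toLex (q, n) = toLex (q', n') := congrArg Subtype.val e
  simpa using h1

theorem XF.cov_iff {f : ℕ → Bool} {q q' : ℚ} {n n' : ℕ} {h : n ≤ gsz f q} {h' : n' ≤ gsz f q'} :
    XF.mk q n h ⋖ XF.mk q' n' h' ↔ q = q' ∧ n' = n + 1 := by
  constructor
  · rintro ⟨h1, h2⟩
    rw [XF.lt_iff] at h1
    rcases h1 with h1 | ⟨rfl, h1⟩
    · exfalso
      obtain ⟨r, hr1, hr2⟩ := exists_between h1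
      exact h2 (c := XF.mk r 0 (Nat.zero_le _)) (XF.lt_iff.2 (Or.inl hr1)) (XF.lt_iff.2 (Or.inl hr2))
    · refine ⟨rfl, ?_⟩
      by_contra hne
      exact h2 (c := XF.mk q (n + 1) (by omega)) (XF.lt_iff.2 (Or.inr ⟨rfl, by omega⟩))
        (XF.lt_iff.2 (Or.inr ⟨rfl, by omega⟩))
  · rintro ⟨rfl, rfl⟩
    refine ⟨XF.lt_iff.2 (Or.inr ⟨rfl, by omega⟩), fun x h1 h2 => ?_⟩
    obtain ⟨r, m, hm, rfl⟩ := x.cases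
    rw [XF.lt_iff] at h1 h2
    rcases h1 with h1 | ⟨rfl, h1⟩
    · rcases h2 with h2 | ⟨rfl, h2⟩
      · exact absurd (h1.trans h2) (lt_irrefl _)
      · exact absurd h1 (lt_irrefl _)
    · rcases h2 with h2 | ⟨-, h2⟩
      · exact absurd h2 (lt_irrefl _)
      · omega

/-- existence of a maximal covering chain with `n+1` elements -/
def Inv (X : Type) [Preorder X] (n : ℕ) : Prop :=
  ∃ s : ℕ → X, (∀ i < n, s i ⋖ s (i + 1)) ∧ (∀ y, ¬ y ⋖ s 0) ∧ ∀ y, ¬ s n ⋖ y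

theorem Inv.map {X Y : Type} [Preorder X] [Preorder Y] (e : X ≃o Y) {n : ℕ} (h : Inv X n) :
    Inv Y n := by
  obtain ⟨s, h1, h2, h3⟩ := h
  refine ⟨fun i => e (s i), fun i hi => ?_, fun y => ?_, fun y => ?_⟩
  · exact (apply_covBy_apply_iff e).2 (h1 i hi)
  · obtain ⟨x, rfl⟩ := e.surjective y
    exact fun h => h2 x ((apply_covBy_apply_iff e).1 h)
  · obtain ⟨x, rfl⟩ := e.surjective y
    exact fun h => h3 x ((apply_covBy_apply_iff e).1 h)

theorem XF.inv_iff (f : ℕ → Bool) (n : ℕ) : Inv (XF f) n ↔ ∃ q, gsz f q = n := by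
  constructor
  · rintro ⟨s, h1, h2, h3⟩
    obtain ⟨q, m, hm, e⟩ := (s 0).cases
    have hm0 : m = 0 := by
      by_contra hne
      refine h2 (XF.mk q (m - 1) (by omega)) ?_
      rw [e, XF.cov_iff]
      exact ⟨rfl, by omega⟩
    subst hm0
    have key : ∀ i, i ≤ n → ∃ h : i ≤ gsz f q, s i = XF.mk q i h := by
      intro i
      induction i with
      | zero => intro _; exact ⟨hm, e⟩
      | succ i ih =>
        intro hi
        obtain ⟨h4, h5⟩ := ih (by omega)
        have h6 := h1 i (by omega)
        obtain ⟨q', m', hm', e'⟩ := (s (i+1)).cases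
        rw [h5, e', XF.cov_iff] at h6
        obtain ⟨rfl, rfl⟩ := h6
        exact ⟨hm', e'⟩
    obtain ⟨h4, h5⟩ := key n le_rfl
    refine ⟨q, ?_⟩
    by_contra hne
    refine h3 (XF.mk q (n + 1) (by omega)) ?_
    rw [h5, XF.cov_iff]
    exact ⟨rfl, rfl⟩
  · rintro ⟨q, rfl⟩
    refine ⟨fun i => XF.mk q (min i (gsz f q)) (min_le_right _ _), fun i hi => ?_, fun y hy => ?_,
      fun y hy => ?_⟩
    · rw [XF.cov_iff]; exact ⟨rfl, by omega⟩
    · obtain ⟨r, m, hm, rfl⟩ := y.cases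
      rw [XF.cov_iff] at hy
      omega
    · obtain ⟨r, m, hm, rfl⟩ := y.cases
      rw [XF.cov_iff] at hy
      obtain ⟨rfl, h⟩ := hy
      omega

theorem XF.eq_of_iso {f g : ℕ → Bool} (e : XF f ≃o XF g) : f = g := by
  have h1 : ∀ (f : ℕ → Bool) m, f m = true ↔ Inv (XF f) (m + 1) := by
    intro f m
    rw [XF.inv_iff]
    constructor
    · intro h
      refine ⟨(Denumerable.eqv ℚ).symm m, ?_⟩
      simp [gsz, h]
    · rintro ⟨q, hq⟩
      unfold gsz at hq
      split_ifs at hq with h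
      have : Denumerable.eqv ℚ q = m := by omega
      rwa [this] at h
  funext m
  rw [Bool.eq_iff_iff, h1, h1]
  exact ⟨Inv.map e, Inv.map e.symm⟩

end DiscMod

namespace DiscMod

section
variable {L : FirstOrder.Language.{u, v}} {M : Type w} [L.Structure M]

theorem realize_countable (hL : L.card ≤ ℵ₀) [Infinite M] (ψ : ℕ → L.Formula Unit)
    (hanti : ∀ n (x : Unit → M), (ψ (n + 1)).Realize x → (ψ n).Realize x)
    (hne : ∀ n, ∃ x : Unit → M, (ψ n).Realize x) :
    ∃ (S : L.Structure ℕ) (t : ℕ), (∀ φ : L.Sentence, M ⊨ φ → ℕ ⊨ φ) ∧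
      ∀ n, (ψ n).Realize (fun _ : Unit => t) := by
  have hm : ∀ m n, m ≤ n → ∀ x : Unit → M, (ψ n).Realize x → (ψ m).Realize x := by
    intro m n hmn
    induction n, hmn using Nat.le_induction with
    | base => exact fun x h => h
    | succ n _ ih => exact fun x h => ih x (hanti n x h)
  choose x hx using hne
  let U : Ultrafilter ℕ := Filter.hyperfilter ℕ
  let P := (U : Filter ℕ).Product (fun _ => M)
  let mk : (ℕ → M) → P := fun x => (x : (U : Filter ℕ).Product (fun _ => M))
  have los : ∀ {β : Type} (φ : L.Formula β) (x : β → ℕ → M),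
      φ.Realize (fun i => mk (x i)) ↔ ∀ᶠ n in (U : Filter ℕ), φ.Realize fun i => x i n :=
    fun φ x => Ultraproduct.realize_formula_cast φ x
  have hU : ∀ m, ∀ᶠ n in (U : Filter ℕ), m ≤ n := by
    intro m
    have : (Filter.hyperfilter ℕ : Filter ℕ) ≤ Filter.atTop := by
      rw [← Nat.cofinite_eq_atTop]; exact Filter.hyperfilter_le_cofinite
    exact this (Filter.eventually_ge_atTop m)
  have hPM : P ≅[L] M := by
    rw [elementarilyEquivalent_iff]
    intro φ
    have := Ultraproduct.sentence_realize (M := fun _ : ℕ => M) (u := U) φ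
    refine this.trans ?_
    simp
  have : Infinite P := hPM.symm.infinite
  let a : Unit → P := fun i => mk (fun n => x n i)
  have ha : ∀ n, (ψ n).Realize a := by
    intro n
    refine (los (ψ n) (fun i n => x n i)).2 ?_
    filter_upwards [hU n] with k hk
    exact hm n k hk _ (hx k)
  obtain ⟨S, a', h1, -⟩ := omitting hL a {⊤} (by
    rintro R - ⟨x, hx⟩
    exact ⟨⊤, rfl, x, hx, by simp⟩)
  refine ⟨S, a' (), fun φ hφ => ?_, fun n => (h1 (ψ n)).2 (ha n)⟩
  have h2 : P ⊨ φ := (hPM.realize_sentence φ).2 hφ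
  have h3 := h1 (φ.relabel (Empty.elim))
  rw [Formula.realize_relabel, Formula.realize_relabel] at h3
  have e1 : a' ∘ Empty.elim = (default : Empty → ℕ) := Subsingleton.elim _ _
  have e2 : a ∘ Empty.elim = (default : Empty → P) := Subsingleton.elim _ _
  rw [e1, e2] at h3
  have h4 := h3.2 h2
  unfold Sentence.Realize
  convert h4

/-- one step of the binary tree -/
def tree (χ : L.Formula Unit → L.Formula Unit) (f : ℕ → Bool) : ℕ → L.Formula Unit
  | 0 => ⊤
  | n + 1 => tree χ f n ⊓ (if f n then χ (tree χ f n) else (χ (tree χ f n)).not)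

theorem tree_congr (χ : L.Formula Unit → L.Formula Unit) (f g : ℕ → Bool) (n : ℕ)
    (h : ∀ m < n, f m = g m) : tree χ f n = tree χ g n := by
  induction n with
  | zero => rfl
  | succ n ih =>
    simp only [tree]
    rw [ih fun m hm => h m (by omega), h n (by omega)]

theorem tree_incons {N : Type*} [L.Structure N] {N' : Type*} [L.Structure N']
    (χ : L.Formula Unit → L.Formula Unit) (f g : ℕ → Bool)
    (t : N) (t' : N') (hf : ∀ n, (tree χ f n).Realize (fun _ : Unit => t))
    (hg : ∀ n, (tree χ g n).Realize (fun _ : Unit => t')) (e : N ≃[L] N') (he : e t = t') :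
    f = g := by
  by_contra hne
  have hex : ∃ n, f n ≠ g n := by
    by_contra hc
    push Not at hc
    exact hne (funext hc)
  classical
  have h1 := Nat.find_spec hex
  have h2 : ∀ m < Nat.find hex, f m = g m := fun m hm => by
    have := Nat.find_min hex hm
    simpa using this
  set n := Nat.find hex
  have h3 := tree_congr χ f g n h2
  have h4 := hf (n + 1)
  have h5 := hg (n + 1)
  have hreal : ∀ φ : L.Formula Unit, φ.Realize (fun _ : Unit => t') ↔
      φ.Realize (fun _ : Unit => t) := by
    intro φ
    rw [← he]
    exact StrongHomClass.realize_formula e φ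
  rw [hreal] at h5
  simp only [tree] at h4 h5
  rw [← h3] at h5
  rw [Formula.realize_inf] at h4 h5
  cases hfn : f n <;> cases hgn : g n <;> simp_all

theorem thmG {D : M → Prop} {lt : M → M → Prop} {c : ℕ → M} (hL : L.card ≤ ℵ₀) [Infinite M]
    (h : OSeq L D lt c) :
    ∃ (S : (ℕ → Bool) → L.Structure ℕ) (t : (ℕ → Bool) → ℕ),
      (∀ f (φ : L.Sentence), M ⊨ φ → @Sentence.Realize L ℕ (S f) φ) ∧
      ∀ f g (e : @Language.Equiv L ℕ ℕ (S f) (S g)), @Language.Equiv.toEquiv L ℕ ℕ (S f) (S g) e (t f) = t g → f = g := by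
  classical
  let J : L.Formula Unit → Set ℕ := fun ψ => {i | ψ.Realize (fun _ => c i)}
  by_cases hA : ∀ ψ, (J ψ).Infinite → ∃ χ, (J (ψ ⊓ χ)).Infinite ∧ (J (ψ ⊓ χ.not)).Infinite
  · choose! χ h1 h2 using hA
    have hinf : ∀ f n, (J (tree χ f n)).Infinite := by
      intro f n
      induction n with
      | zero =>
        have : J (tree χ f 0) = Set.univ := by ext i; simp [J, tree]
        rw [this]; exact Set.infinite_univ
      | succ n ih =>
        simp only [tree]
        split_ifs
        · exact h1 _ ih
        · exact h2 _ ih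
    have := fun f => realize_countable (M := M) hL (tree χ f)
      (fun n x hx => by
        simp only [tree] at hx
        exact (Formula.realize_inf.1 hx).1)
      (fun n => by
        obtain ⟨i, hi⟩ := (hinf f n).nonempty
        exact ⟨_, hi⟩)
    choose S t hS ht using this
    refine ⟨S, t, hS, fun f g e he => ?_⟩
    exact @tree_incons L ℕ (S f) ℕ (S g) χ f g (t f) (t g) (ht f) (ht g) e he
  · push Not at hA
    obtain ⟨ψ, hψ, hns⟩ := hA
    have : Infinite (J ψ) := hψ.to_subtype
    let e := Nat.orderEmbeddingOfSet (J ψ)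
    have hr : Set.range e = J ψ := Nat.orderEmbeddingOfSet_range _
    have he : ∀ i, ψ.Realize (fun _ => c (e i)) := fun i => by
      have : e i ∈ J ψ := hr ▸ ⟨i, rfl⟩
      exact this
    let Q : M → Prop := fun x => ψ.Realize (fun _ => x)
    have dQ : ∀ {α : Type} (i : α), Dfn L (fun x : α → M => Q (x i)) := fun i =>
      (Dfn.of (M := M) ψ).sub (fun _ => i)
    have h' : OSeq L (fun x => D x ∧ Q x) (fun x y => lt x y ∧ Q x ∧ Q y) (fun i => c (e i)) :=
      { dD := h.dD.and (dQ ())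
        dlt := h.dlt.and ((dQ 0).and (dQ 1))
        ltD := fun x y hxy => ⟨⟨(h.ltD x y hxy.1).1, hxy.2.1⟩, (h.ltD x y hxy.1).2, hxy.2.2⟩
        irr := fun x hx => h.irr x hx.1
        trans := fun x y z h1 h2 => ⟨h.trans x y z h1.1 h2.1, h1.2.1, h2.2.2⟩
        tot := fun x y hx hy => by
          rcases h.tot x y hx.1 hy.1 with h1 | h1 | h1
          · exact Or.inl h1
          · exact Or.inr (Or.inl ⟨h1, hx.2, hy.2⟩)
          · exact Or.inr (Or.inr ⟨h1, hy.2, hx.2⟩)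
        cD := fun i => ⟨h.cD _, he i⟩
        clt := fun i j hij => ⟨h.clt _ _ (e.strictMono hij), he i, he j⟩
        ini := fun i x hx => by
          obtain ⟨j, rfl⟩ := h.ini _ x hx.1
          have : j ∈ Set.range e := by rw [hr]; exact hx.2.1
          obtain ⟨k, rfl⟩ := this
          exact ⟨k, rfl⟩ }
    have hs : ∀ R : (Unit → ℕ) → Prop, Tr L (fun i => c (e i)) R →
        ∃ K : ℕ, ∃ v : Prop, ∀ u, K ≤ u () → (R u ↔ v) := by
      rintro R ⟨χ, hχ⟩
      have bd : ∀ χ : L.Formula Unit, ¬ (J (ψ ⊓ χ)).Infinite →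
          ∃ K, ∀ n, K ≤ n → ¬ χ.Realize (fun _ => c (e n)) := by
        intro χ hf
        rw [Set.not_infinite] at hf
        obtain ⟨K, hK⟩ := hf.bddAbove
        refine ⟨K + 1, fun n hn hc => ?_⟩
        have h1 : e n ≤ K := hK (Formula.realize_inf.2 ⟨he n, hc⟩)
        have h2 : n ≤ e n := e.strictMono.le_apply
        omega
      by_cases hc : (J (ψ ⊓ χ)).Infinite
      · obtain ⟨K, hK⟩ := bd χ.not (Set.not_infinite.2 (hns χ hc))
        refine ⟨K, True, fun u hu => ?_⟩
        have := hK _ hu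
        rw [Formula.realize_not, not_not] at this
        simpa using (hχ u).1 this
      · obtain ⟨K, hK⟩ := bd χ hc
        refine ⟨K, False, fun u hu => ?_⟩
        have := hK _ hu
        simpa using fun h => this ((hχ u).2 h)
    choose dst hdst using fun k => h'.dDst k (0 : Fin 2) 1
    have hdst' : ∀ k x y, (dst k).Realize ![x, y] ↔
        Dst (fun x y => lt x y ∧ Q x ∧ Q y) k x y := fun k x y => hdst k _
    choose S a hSa using fun f => exists_mod hL h' hs dst hdst' (XF f)
    refine ⟨S, fun _ => 0, fun f φ hφ => @IsMod.elem _ _ _ _ _ _ _ _ (S f) _ (hSa f) φ hφ, fun f g e _ => ?_⟩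
    obtain ⟨o⟩ := @iso_order _ _ _ _ _ _ h' dst hdst' _ _ _ _ _ _ (S f) (S g) _ _ (hSa f) (hSa g) e
    exact XF.eq_of_iso o

end
end DiscMod

namespace DiscMod

section
variable {L : FirstOrder.Language.{u, v}} {M : Type w} [L.Structure M]

/-- definable sets containing `P` -/
def Nb (L : FirstOrder.Language.{u, v}) {M : Type w} [L.Structure M] (P : Set M)
    (Q : M → Prop) : Prop :=
  Dfn L (fun x : Unit → M => Q (x ())) ∧ ∀ x ∈ P, Q x

theorem Nb.d {P : Set M} {Q : M → Prop} (h : Nb L P Q) {α : Type*} (i : α) :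
    Dfn L (fun x : α → M => Q (x i)) := h.1.sub (fun _ => i)

theorem Nb.and {P : Set M} {Q Q' : M → Prop} (h : Nb L P Q) (h' : Nb L P Q') :
    Nb L P (fun x => Q x ∧ Q' x) := ⟨h.1.and h'.1, fun x hx => ⟨h.2 x hx, h'.2 x hx⟩⟩

theorem Nb.top {P : Set M} : Nb L P (fun _ => True) := ⟨Dfn.const True, fun _ _ => trivial⟩

/-- the homogeneity property: a definable property true at one point of `P` is true on `P` -/
theorem locus_hom {p : Set (L.Formula (↥(∅ : Set M) ⊕ Fin 1))}
    (hcomp : PaperDef.IsCompleteType (∅ : Set M) p) {Q : M → Prop}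
    (hQ : Dfn L (fun x : Unit → M => Q (x ()))) {a : M}
    (ha : a ∈ PaperDef.typeSet (∅ : Set M) p) (h : Q a) :
    Nb L (PaperDef.typeSet (∅ : Set M) p) Q := by
  refine ⟨hQ, fun x hx => ?_⟩
  obtain ⟨φ, hφ⟩ := hQ
  let ψ : L.Formula (↥(∅ : Set M) ⊕ Fin 1) := φ.relabel (fun _ => Sum.inr 0)
  have hψ : ∀ y, ψ.Realize (PaperDef.pval ![y]) ↔ Q y := by
    intro y
    show (φ.relabel _).Realize _ ↔ _
    rw [Formula.realize_relabel, hφ]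
    rfl
  rcases hcomp.2 ψ with h1 | h1
  · exact (hψ x).1 (hx _ h1)
  · have h2 := ha _ h1
    have h3 : ¬ ψ.Realize (PaperDef.pval ![a]) := h2
    exact absurd ((hψ a).2 h) h3

theorem locus_mem {p : Set (L.Formula (↥(∅ : Set M) ⊕ Fin 1))} {x : M}
    (h : ∀ Q, Nb L (PaperDef.typeSet (∅ : Set M) p) Q → Q x) :
    x ∈ PaperDef.typeSet (∅ : Set M) p := by
  intro φ hφ
  refine h (fun x => φ.Realize (PaperDef.pval ![x])) ⟨?_, fun y hy => hy φ hφ⟩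
  refine ⟨φ.relabel (Sum.elim (fun e => (e.2 : False).elim) (fun _ => ())), fun y => ?_⟩
  rw [Formula.realize_relabel]
  have : (y ∘ (Sum.elim (fun e => (e.2 : False).elim) (fun _ => ()) :
      ↥(∅ : Set M) ⊕ Fin 1 → Unit)) = PaperDef.pval ![y ()] := by
    funext i
    rcases i with i | i
    · exact (i.2 : False).elim
    · have : i = 0 := Subsingleton.elim _ _
      subst this; rfl
  rw [this]

/-- uniformity from saturation -/
theorem unif (hsat : PaperDef.IsAleph1Saturated L M)
    {p : Set (L.Formula (↥(∅ : Set M) ⊕ Fin 1))}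
    {α : Type} [Countable α] (a : α → M) (R : (M → Prop) → (Option α → M) → Prop)
    (hR : ∀ Q, Nb L (PaperDef.typeSet (∅ : Set M) p) Q → Dfn L (R Q))
    (hmono : ∀ Q Q' : M → Prop, (∀ x, Q x → Q' x) → ∀ y, R Q' y → R Q y)
    (h : ∀ x ∈ PaperDef.typeSet (∅ : Set M) p,
      ∃ Q, Nb L (PaperDef.typeSet (∅ : Set M) p) Q ∧ R Q (ext a x)) :
    ∃ Q, Nb L (PaperDef.typeSet (∅ : Set M) p) Q ∧ ∀ x, Q x → R Q (ext a x) := by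
  classical
  set P := PaperDef.typeSet (∅ : Set M) p with hP
  by_contra hcon
  push Not at hcon
  let A : Set M := Set.range a
  let g : Option α → A ⊕ Fin 1 := fun o => o.elim (Sum.inr 0) (fun i => Sum.inl ⟨a i, i, rfl⟩)
  have hg : ∀ (δ : L.Formula (Option α)) (x : Fin 1 → M),
      (δ.relabel g).Realize (PaperDef.pval x) ↔ δ.Realize (ext a (x 0)) := by
    intro δ x
    rw [Formula.realize_relabel]
    have : PaperDef.pval x ∘ g = ext a (x 0) := by
      funext o; cases o <;> rfl
    rw [this]
  let q : Set (L.Formula (A ⊕ Fin 1)) := {δ' | ∃ δ : L.Formula (Option α), δ' = δ.relabel g ∧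
    ∃ Q, Nb L P Q ∧ ∀ x, Q x → ¬ R Q (ext a x) → δ.Realize (ext a x)}
  have hfs : PaperDef.FinSat A q := by
    intro s hs
    have hall : ∃ Q, Nb L P Q ∧ ∀ x, Q x → ¬ R Q (ext a x) → ∀ φ ∈ s,
        Formula.Realize φ (PaperDef.pval (fun _ => x)) := by
      induction s using Finset.induction_on with
      | empty => exact ⟨_, Nb.top, by simp⟩
      | insert δ' s _ ih =>
        obtain ⟨Q, hQ, hQ'⟩ := ih (fun x hx => hs (Finset.mem_insert_of_mem hx))
        obtain ⟨δ, rfl, Q1, hQ1, hQ1'⟩ := hs (Finset.mem_insert_self δ' s)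
        refine ⟨_, hQ.and hQ1, fun x hx hnx φ hφ => ?_⟩
        rcases Finset.mem_insert.1 hφ with rfl | hφ
        · rw [hg]
          exact hQ1' x hx.2 fun hc => hnx (hmono _ _ (fun z hz => hz.2) _ hc)
        · exact hQ' x hx.1 (fun hc => hnx (hmono _ _ (fun z hz => hz.1) _ hc)) φ hφ
    obtain ⟨Q, hQ, hQ'⟩ := hall
    obtain ⟨x, hx, hnx⟩ := hcon Q hQ
    exact ⟨fun _ => x, hQ' x hx hnx⟩
  obtain ⟨x0, hx0⟩ := hsat A (Set.countable_range a) q hfs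
  have hx : ∀ Q, Nb L P Q → Q x0 ∧ ¬ R Q (ext a x0) := by
    intro Q hQ
    obtain ⟨δ, hδ⟩ := (hQ.d (none : Option α)).and (hR Q hQ).not
    have h1 := hx0 (δ.relabel g) ⟨δ, rfl, Q, hQ, fun x h1 h2 => (hδ _).2 ⟨h1, h2⟩⟩
    rw [hg] at h1
    exact (hδ _).1 h1
  obtain ⟨Q, hQ, hRQ⟩ := h x0 (locus_mem fun Q hQ => (hx Q hQ).1)
  exact (hx Q hQ).2 hRQ

/-- constant version -/
theorem unif1 (hsat : PaperDef.IsAleph1Saturated L M)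
    {p : Set (L.Formula (↥(∅ : Set M) ⊕ Fin 1))}
    {α : Type} [Countable α] (a : α → M) (R : (Option α → M) → Prop)
    (hR : Dfn L R)
    (h : ∀ x ∈ PaperDef.typeSet (∅ : Set M) p, R (ext a x)) :
    ∃ Q, Nb L (PaperDef.typeSet (∅ : Set M) p) Q ∧ ∀ x, Q x → R (ext a x) :=
  unif hsat a (fun _ => R) (fun _ _ => hR) (fun _ _ _ _ h => h)
    (fun x hx => ⟨_, Nb.top, h x hx⟩)

theorem prep (hsat : PaperDef.IsAleph1Saturated L M)
    (p : Set (L.Formula (↥(∅ : Set M) ⊕ Fin 1)))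
    (hcomp : PaperDef.IsCompleteType (∅ : Set M) p)
    (hpinf : (PaperDef.typeSet (∅ : Set M) p).Infinite)
    (F : M → M → Prop) (dF : Dfn L (fun x : Fin 2 → M => F (x 0) (x 1)))
    (hlin : PaperDef.IsLinearOn F (PaperDef.typeSet (∅ : Set M) p))
    (hdisc : PaperDef.IsDiscreteOn F (PaperDef.typeSet (∅ : Set M) p)) :
    ∃ (θ : M → Prop) (c : ℕ → M), Dfn L (fun x : Unit → M => θ (x ())) ∧
      PaperDef.IsLinearOn F {x | θ x} ∧
      (∀ i, θ (c i)) ∧ (∀ i, F (c i) (c (i + 1))) ∧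
      ∀ i z, θ z → ¬ (F (c i) z ∧ F z (c (i + 1))) := by
  set P := PaperDef.typeSet (∅ : Set M) p with hP
  obtain ⟨irr, tra, tot⟩ := hlin
  have dF' : ∀ {α : Type} (i j : α), Dfn L (fun x : α → M => F (x i) (x j)) := fun i j =>
    dF.sub ![i, j]
  -- the order has no maximum
  have nomax : ∀ a ∈ P, ∃ b ∈ P, F a b := by
    intro a ha
    by_contra hc
    push Not at hc
    obtain ⟨Q, hQ, hQ'⟩ := unif1 hsat (p := p) (fun _ : Unit => a)
      (fun x => ¬ F (x (some ())) (x none)) (dF' _ _).not (fun x hx => hc x hx)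
    have h1 : Nb L P (fun x => ∀ y, Q y → ¬ F x y) := by
      refine locus_hom hcomp ?_ ha hQ'
      exact Dfn.all (R := fun (x : Unit → M) y => Q y → ¬ F (x ()) y)
        ((hQ.d _).imp (dF' _ _).not)
    obtain ⟨b, hb, hba⟩ := hpinf.exists_notMem_finset {a}
    have hne : b ≠ a := by simpa using hba
    rcases tot a ha b hb with h2 | h2 | h2
    · exact hne h2.symm
    · exact hc b hb h2
    · exact h1.2 b hb a (hQ.2 a ha) h2
  obtain ⟨a0, ha0⟩ := hpinf.nonempty
  obtain ⟨s0, hs0, has, hsucc⟩ := hdisc.1 a0 ha0 (nomax a0 ha0)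
  -- irreflexivity
  have N1 : Nb L P (fun x => ¬ F x x) := ⟨(dF' () ()).not, irr⟩
  -- totality
  obtain ⟨Q2, hQ2, h2⟩ : ∃ Q, Nb L P Q ∧ ∀ y, Q y → (a0 = y ∨ F a0 y ∨ F y a0) :=
    unif1 hsat (p := p) (fun _ : Unit => a0)
      (fun x => x (some ()) = x none ∨ F (x (some ())) (x none) ∨ F (x none) (x (some ())))
      ((Dfn.eq _ _).or ((dF' _ _).or (dF' _ _))) (fun x hx => tot a0 ha0 x hx)
  have N2 : Nb L P (fun x => ∀ y, Q2 y → (x = y ∨ F x y ∨ F y x)) := by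
    refine locus_hom hcomp ?_ ha0 h2
    exact Dfn.all (R := fun (x : Unit → M) y => Q2 y → (x () = y ∨ F (x ()) y ∨ F y (x ())))
      ((hQ2.d _).imp ((Dfn.eq _ _).or ((dF' _ _).or (dF' _ _))))
  -- transitivity
  obtain ⟨Q3, hQ3, h3⟩ : ∃ Q, Nb L P Q ∧ ∀ y, Q y → ∀ z, Q z → F a0 y → F y z → F a0 z := by
    refine unif hsat (p := p) (fun _ : Unit => a0)
      (fun Q x => ∀ z, Q z → F (x (some ())) (x none) → F (x none) z → F (x (some ())) z)
      ?_ ?_ ?_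
    · intro Q hQ
      exact Dfn.all (R := fun (x : Option Unit → M) z =>
        Q z → F (x (some ())) (x none) → F (x none) z → F (x (some ())) z)
        ((hQ.d _).imp ((dF' _ _).imp ((dF' _ _).imp (dF' _ _))))
    · exact fun Q Q' hQ y hy z hz => hy z (hQ z hz)
    · intro y hy
      exact unif1 hsat (p := p) (fun i : Bool => if i then a0 else y)
        (fun x => F (x (some true)) (x (some false)) → F (x (some false)) (x none) →
          F (x (some true)) (x none)) ((dF' _ _).imp ((dF' _ _).imp (dF' _ _)))
        (fun z hz => tra a0 ha0 y hy z hz)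
  have N3 : Nb L P (fun x => ∀ y, Q3 y → ∀ z, Q3 z → F x y → F y z → F x z) := by
    refine locus_hom hcomp ?_ ha0 h3
    have d1 : Dfn L (fun x : Option Unit → M => ∀ z, Q3 (x none) → Q3 z → F (x (some ())) (x none) →
        F (x none) z → F (x (some ())) z) :=
      Dfn.all (R := fun (x : Option Unit → M) z => Q3 (x none) → Q3 z →
        F (x (some ())) (x none) → F (x none) z → F (x (some ())) z)
        ((hQ3.d _).imp ((hQ3.d _).imp ((dF' _ _).imp ((dF' _ _).imp (dF' _ _)))))
    refine (Dfn.all (R := fun (x : Unit → M) y => ∀ z, Q3 y → Q3 z → F (x ()) y →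
        F y z → F (x ()) z) d1).congr fun x => ?_
    exact ⟨fun h y hy z hz => h y z hy hz, fun h y z hy hz => h y hy z hz⟩
  -- no elements between `a0` and its successor
  obtain ⟨Q4, hQ4, h4⟩ : ∃ Q, Nb L P Q ∧ ∀ z, Q z → ¬ (F a0 z ∧ F z s0) := by
    refine unif1 hsat (p := p) (fun i : Bool => if i then a0 else s0)
        (fun x => ¬ (F (x (some true)) (x none) ∧ F (x none) (x (some false))))
        ((dF' _ _).and (dF' _ _)).not (fun z hz => ?_)
    rintro ⟨h1, h2⟩
    have h1 : F a0 z := h1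
    have h2 : F z s0 := h2
    rcases hsucc z hz h1 with h3 | h3
    · subst h3; exact irr _ hz h2
    · exact irr _ hz (tra z hz s0 hs0 z hz h2 h3)
  obtain ⟨θ, hθ, hθe⟩ : ∃ θ, Nb L P θ ∧ ∀ x, θ x → (¬ F x x) ∧
      (Q2 x ∧ ∀ y, Q2 y → (x = y ∨ F x y ∨ F y x)) ∧
      (Q3 x ∧ ∀ y, Q3 y → ∀ z, Q3 z → F x y → F y z → F x z) ∧ Q4 x :=
    ⟨_, N1.and ((hQ2.and N2).and ((hQ3.and N3).and hQ4)), fun x hx => hx⟩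
  have tirr : ∀ x, θ x → ¬ F x x := fun x hx => (hθe x hx).1
  have ttot : ∀ x, θ x → ∀ y, θ y → (x = y ∨ F x y ∨ F y x) := fun x hx y hy =>
    (hθe x hx).2.1.2 y (hθe y hy).2.1.1
  have ttra : ∀ x, θ x → ∀ y, θ y → ∀ z, θ z → F x y → F y z → F x z := fun x hx y hy z hz =>
    (hθe x hx).2.2.1.2 y (hθe y hy).2.2.1.1 z (hθe z hz).2.2.1.1
  -- successors
  have hsu : ∀ Q, Nb L P Q → Nb L P (fun x => ∃ y, (θ y ∧ Q y ∧ F x y) ∧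
      ∀ z, θ z → ¬ (F x z ∧ F z y)) := by
    intro Q hQ
    refine locus_hom hcomp ?_ ha0 ⟨s0, ⟨hθ.2 _ hs0, hQ.2 _ hs0, has⟩,
      fun z hz => h4 z (hθe z hz).2.2.2⟩
    have d1 : Dfn L (fun x : Option Unit → M => ∀ z, θ z →
        ¬ (F (x (some ())) z ∧ F z (x none))) :=
      Dfn.all (R := fun (x : Option Unit → M) z => θ z →
        ¬ (F (x (some ())) z ∧ F z (x none)))
        ((hθ.d _).imp ((dF' _ _).and (dF' _ _)).not)
    exact Dfn.ex (R := fun (x : Unit → M) y => (θ y ∧ Q y ∧ F (x ()) y) ∧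
      ∀ z, θ z → ¬ (F (x ()) z ∧ F z y)) (((hθ.d _).and ((hQ.d _).and (dF' _ _))).and d1)
  have hS : ∀ a : P, ∃ b : P, F a b ∧ ∀ z, θ z → ¬ (F a z ∧ F z b) := by
    rintro ⟨a, ha⟩
    obtain ⟨y, ⟨hy1, -, hy2⟩, hy3⟩ := (hsu _ Nb.top).2 a ha
    have hyP : y ∈ P := by
      refine locus_mem fun Q hQ => ?_
      obtain ⟨y', ⟨hy1', hq, hy2'⟩, hy3'⟩ := (hsu Q hQ).2 a ha
      rcases ttot y hy1 y' hy1' with h | h | h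
      · rw [h]; exact hq
      · exact absurd ⟨hy2, h⟩ (hy3' y hy1)
      · exact absurd ⟨hy2', h⟩ (hy3 y' hy1')
    exact ⟨⟨y, hyP⟩, hy2, hy3⟩
  choose S hS1 hS2 using hS
  let c : ℕ → P := fun n => S^[n] ⟨a0, ha0⟩
  have hc : ∀ i, c (i + 1) = S (c i) := fun i => Function.iterate_succ_apply' S i _
  refine ⟨θ, fun i => c i, hθ.1, ⟨tirr, ttra, ttot⟩, fun i => hθ.2 _ (c i).2, fun i => ?_,
    fun i z hz => ?_⟩
  · simp only [hc]; exact hS1 _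
  · simp only [hc]; exact hS2 _ z hz

end
end DiscMod

namespace DiscMod

section
variable {L : FirstOrder.Language.{u, v}} {M : Type w} [L.Structure M]

theorem Dfn.lift {L' : FirstOrder.Language.{u, v}} [L'.Structure M] (j : L →ᴸ L')
    [j.IsExpansionOn M] {α : Type*} {R : (α → M) → Prop} (h : Dfn L R) : Dfn L' R := by
  obtain ⟨φ, hφ⟩ := h
  exact ⟨j.onFormula φ, fun x => by rw [LHom.realize_onFormula]; exact hφ x⟩

theorem oseq_const (F : M → M → Prop) (dF : Dfn L (fun x : Fin 2 → M => F (x 0) (x 1)))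
    (θ : M → Prop) (c : ℕ → M) (dθ : Dfn L (fun x : Unit → M => θ (x ())))
    (hlin : PaperDef.IsLinearOn F {x | θ x})
    (hc : ∀ i, θ (c i)) (hcF : ∀ i, F (c i) (c (i + 1)))
    (hno : ∀ i z, θ z → ¬ (F (c i) z ∧ F z (c (i + 1)))) :
    letI : (constantsOn Unit).Structure M := constantsOn.structure (fun _ => c 0)
    ∃ D lt, OSeq (L[[Unit]]) D lt c := by
  let : (constantsOn Unit).Structure M := constantsOn.structure (fun _ => c 0)
  obtain ⟨irr, tra, tot⟩ := hlin
  have dF1 : Dfn (L[[Unit]]) (fun x : Fin 2 → M => F (x 0) (x 1)) :=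
    dF.lift (L.lhomWithConstants Unit)
  have dF' : ∀ {α : Type} (i j : α), Dfn (L[[Unit]]) (fun x : α → M => F (x i) (x j)) :=
    fun i j => dF1.sub ![i, j]
  have dθ1 : Dfn (L[[Unit]]) (fun x : Unit → M => θ (x ())) :=
    dθ.lift (L.lhomWithConstants Unit)
  have dθ' : ∀ {α : Type} (i : α), Dfn (L[[Unit]]) (fun x : α → M => θ (x i)) :=
    fun i => dθ1.sub (fun _ => i)
  have dc : ∀ {α : Type} (i : α), Dfn (L[[Unit]]) (fun x : α → M => x i = c 0) := fun i =>
    ⟨Term.equal (Term.var i) (Constants.term (L.con ())), fun x => by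
      rw [Formula.realize_equal, Term.realize_constants, Term.realize_var]
      have : ((L.con () : L[[Unit]].Constants) : M) = c 0 := by
        rfl
      rw [this]⟩
  have dcF : ∀ {α : Type} (i : α), Dfn (L[[Unit]]) (fun x : α → M => F (c 0) (x i)) := by
    intro α i
    refine (Dfn.ex (R := fun (x : α → M) y => y = c 0 ∧ F y (x i))
      ((dc _).and (dF' _ _))).congr fun x => ?_
    exact ⟨fun ⟨y, h1, h2⟩ => h1 ▸ h2, fun h => ⟨_, rfl, h⟩⟩
  have dD : ∀ {α : Type} (i : α), Dfn (L[[Unit]])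
      (fun x : α → M => θ (x i) ∧ (x i = c 0 ∨ F (c 0) (x i))) := fun i =>
    (dθ' i).and ((dc i).or (dcF i))
  have clt : ∀ i j, i < j → F (c i) (c j) := by
    intro i j hij
    induction j, hij using Nat.le_induction with
    | base => exact hcF i
    | succ j _ ih => exact tra _ (hc i) _ (hc j) _ (hc _) ih (hcF j)
  have cD : ∀ i, θ (c i) ∧ (c i = c 0 ∨ F (c 0) (c i)) := by
    intro i
    refine ⟨hc i, ?_⟩
    rcases Nat.eq_zero_or_pos i with rfl | hi
    · exact Or.inl rfl
    · exact Or.inr (clt 0 i hi)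
  have asym : ∀ x y, θ x → θ y → F x y → F y x → False := fun x y hx hy h1 h2 =>
    irr x hx (tra x hx y hy x hx h1 h2)
  refine ⟨fun x => θ x ∧ (x = c 0 ∨ F (c 0) x),
    fun x y => (θ x ∧ (x = c 0 ∨ F (c 0) x)) ∧ (θ y ∧ (y = c 0 ∨ F (c 0) y)) ∧ F x y,
    { dD := dD ()
      dlt := (dD 0).and ((dD 1).and (dF' 0 1))
      ltD := fun x y h => ⟨h.1, h.2.1⟩
      irr := fun x h => irr x h.1.1 h.2.2
      trans := fun x y z h h' => ⟨h.1, h'.2.1, tra x h.1.1 y h.2.1.1 z h'.2.1.1 h.2.2 h'.2.2⟩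
      tot := fun x y hx hy => by
        rcases tot x hx.1 y hy.1 with h | h | h
        · exact Or.inl h
        · exact Or.inr (Or.inl ⟨hx, hy, h⟩)
        · exact Or.inr (Or.inr ⟨hy, hx, h⟩)
      cD := cD
      clt := fun i j hij => ⟨cD i, cD j, clt i j hij⟩
      ini := ?_ }⟩
  rintro i x ⟨hx, -, hxi⟩
  induction i with
  | zero =>
    rcases hx.2 with h | h
    · exact ⟨0, h.symm⟩
    · exact (asym _ _ (hc 0) hx.1 h hxi).elim
  | succ i ih =>
    rcases tot x hx.1 (c i) (hc i) with h | h | h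
    · exact ⟨i, h.symm⟩
    · exact ih h
    · exact absurd ⟨h, hxi⟩ (hno i x hx.1)

/-- interpretation of the constant -/
def kon (L : FirstOrder.Language.{u, v}) (N : Type*) [L[[Unit]].Structure N] : N :=
  Structure.funMap (L := L[[Unit]]) (Sum.inr () : L[[Unit]].Functions 0) (Fin.elim0)

theorem lift_equiv {N N' : Type*} [L[[Unit]].Structure N] [L[[Unit]].Structure N']
    [L.Structure N] [L.Structure N'] [(L.lhomWithConstants Unit).IsExpansionOn N]
    [(L.lhomWithConstants Unit).IsExpansionOn N']
    (e : N ≃[L] N') (he : e.toEquiv (kon L N) = kon L N') :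
    ∃ e' : N ≃[L[[Unit]]] N', e'.toEquiv = e.toEquiv := by
  refine ⟨{ toEquiv := e.toEquiv, map_fun' := ?_, map_rel' := ?_ }, rfl⟩
  · intro n f x
    cases f with
    | inl f =>
      rw [withConstants_funMap_sumInl, withConstants_funMap_sumInl]
      exact e.map_fun' f x
    | inr f =>
      cases n with
      | zero =>
        have h1 : x = Fin.elim0 := Subsingleton.elim _ _
        have h2 : (e.toEquiv.toFun ∘ x) = Fin.elim0 := Subsingleton.elim _ _
        cases f
        rw [h2, h1]
        exact he
      | succ n => exact (f : PEmpty).elim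
  · intro n r x
    cases r with
    | inl r =>
      rw [withConstants_relMap_sumInl, withConstants_relMap_sumInl]
      exact e.map_rel' r x
    | inr r => exact (r : Empty).elim

theorem descend (hL : L.card ≤ ℵ₀) [Infinite M] (F : M → M → Prop)
    (dF : Dfn L (fun x : Fin 2 → M => F (x 0) (x 1)))
    (θ : M → Prop) (c : ℕ → M) (dθ : Dfn L (fun x : Unit → M => θ (x ())))
    (hlin : PaperDef.IsLinearOn F {x | θ x})
    (hc : ∀ i, θ (c i)) (hcF : ∀ i, F (c i) (c (i + 1)))
    (hno : ∀ i z, θ z → ¬ (F (c i) z ∧ F z (c (i + 1)))) :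
    ∃ (S : (ℕ → Bool) → L.Structure ℕ) (t t' : (ℕ → Bool) → ℕ),
      (∀ f (φ : L.Sentence), M ⊨ φ → @Sentence.Realize L ℕ (S f) φ) ∧
      ∀ f g (e : @Language.Equiv L ℕ ℕ (S f) (S g)),
        @Language.Equiv.toEquiv L ℕ ℕ (S f) (S g) e (t f) = t g →
        @Language.Equiv.toEquiv L ℕ ℕ (S f) (S g) e (t' f) = t' g → f = g := by
  let : (constantsOn Unit).Structure M := constantsOn.structure (fun _ => c 0)
  obtain ⟨D, lt, ho⟩ := oseq_const F dF θ c dθ hlin hc hcF hno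
  have hL' : (L[[Unit]]).card ≤ ℵ₀ := by
    rw [card_withConstants]
    simpa using hL
  obtain ⟨S, t, h1, h2⟩ := thmG hL' ho
  refine ⟨fun f => @LHom.reduct _ _ (L.lhomWithConstants Unit) ℕ (S f), t,
    fun f => @kon L ℕ (S f), fun f φ hφ => ?_, fun f g e he he' => ?_⟩
  · let := S f
    let : L.Structure ℕ := (L.lhomWithConstants Unit).reduct ℕ
    have : (L.lhomWithConstants Unit).IsExpansionOn ℕ := LHom.isExpansionOn_reduct _ _
    have h3 := h1 f ((L.lhomWithConstants Unit).onSentence φ)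
      ((LHom.realize_onSentence M (L.lhomWithConstants Unit) φ).2 hφ)
    exact (LHom.realize_onSentence ℕ (L.lhomWithConstants Unit) φ).1 h3
  · obtain ⟨e', hh⟩ := @lift_equiv L ℕ ℕ (S f) (S g)
      (@LHom.reduct _ _ (L.lhomWithConstants Unit) ℕ (S f))
      (@LHom.reduct _ _ (L.lhomWithConstants Unit) ℕ (S g))
      (@LHom.isExpansionOn_reduct _ _ (L.lhomWithConstants Unit) ℕ (S f))
      (@LHom.isExpansionOn_reduct _ _ (L.lhomWithConstants Unit) ℕ (S g)) e he'
    exact h2 f g e' (by rw [hh]; exact he)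

end
end DiscMod

namespace DiscMod

section
variable {L : FirstOrder.Language.{u, v}}

theorem equiv_of_diagram {N N' : Type*} [L.Structure N] [L.Structure N'] (e : ℕ ≃ N) (e' : ℕ ≃ N')
    (h : {φ : L.Formula ℕ | φ.Realize e} = {φ : L.Formula ℕ | φ.Realize e'}) :
    Nonempty (N ≃[L] N') := by
  have h' : ∀ φ : L.Formula ℕ, φ.Realize e ↔ φ.Realize e' := fun φ => Set.ext_iff.1 h φ
  refine ⟨{ toEquiv := e.symm.trans e', map_fun' := ?_, map_rel' := ?_ }⟩
  · intro n f x
    have h1 := h' (Term.equal (Term.var (e.symm (Structure.funMap f x)))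
      (Term.func f (fun i => Term.var (e.symm (x i)))))
    rw [Formula.realize_equal, Formula.realize_equal] at h1
    simp only [Term.realize_var, Term.realize_func, Equiv.apply_symm_apply, true_iff] at h1
    exact h1
  · intro n r x
    have h1 := h' (Relations.formula r (fun i => Term.var (e.symm (x i))))
    rw [Formula.realize_rel, Formula.realize_rel] at h1
    simp only [Term.realize_var, Equiv.apply_symm_apply] at h1
    exact h1.symm

theorem upper (hL : L.card ≤ ℵ₀) (T : L.Theory) : PaperDef.numCountableModels T ≤ 2 ^ ℵ₀ := by
  have hct := countable_formula hL (α := ℕ)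
  let en : ∀ q : Quotient (PaperDef.countableModelSetoid T), ℕ ≃ q.out.1 := fun q =>
    haveI := q.out.2.1
    haveI := q.out.2.2
    (nonempty_equiv_of_countable (α := ℕ) (β := q.out.1)).some
  let Φ : Quotient (PaperDef.countableModelSetoid T) → Set (L.Formula ℕ) := fun q =>
    {φ | φ.Realize (en q)}
  have hinj : Function.Injective Φ := by
    intro q q' h
    have h1 := equiv_of_diagram (en q) (en q') h
    have h3 := Quotient.sound (s := PaperDef.countableModelSetoid T) (a := q.out) (b := q'.out) h1
    rwa [Quotient.out_eq, Quotient.out_eq] at h3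
  have h1 := Cardinal.mk_le_of_injective
    (f := fun q => (ULift.up.{max u v 1} (Φ q))) (fun q q' h => hinj (ULift.up_injective h))
  refine le_trans h1 ?_
  rw [Cardinal.mk_uLift, Cardinal.mk_set]
  have h2 : #(L.Formula ℕ) ≤ ℵ₀ := Cardinal.mk_le_aleph0
  simp only [Cardinal.lift_power, Cardinal.lift_ofNat]
  refine Cardinal.power_le_power_left two_ne_zero ?_
  exact Cardinal.lift_le_aleph0.2 h2

theorem lower (T : L.Theory) (S : (ℕ → Bool) → L.Structure ℕ) (t t' : (ℕ → Bool) → ℕ)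
    (hS : ∀ f, @Theory.Model L ℕ (S f) T)
    (hrig : ∀ f g (e : @Language.Equiv L ℕ ℕ (S f) (S g)),
        @Language.Equiv.toEquiv L ℕ ℕ (S f) (S g) e (t f) = t g →
        @Language.Equiv.toEquiv L ℕ ℕ (S f) (S g) e (t' f) = t' g → f = g) :
    2 ^ ℵ₀ ≤ PaperDef.numCountableModels T := by
  let N : (ℕ → Bool) → {N : Theory.ModelType.{u, v, 0} T // Countable N ∧ Infinite N} := fun f =>
    ⟨@Theory.ModelType.mk L T ℕ (S f) (hS f) _, inferInstanceAs (Countable ℕ),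
      inferInstanceAs (Infinite ℕ)⟩
  let Φ : (ℕ → Bool) → Quotient (PaperDef.countableModelSetoid T) := fun f => Quotient.mk _ (N f)
  have hfib : ∀ q, (Φ ⁻¹' {q}).Countable := by
    intro q
    rcases (Φ ⁻¹' {q}).eq_empty_or_nonempty with h0 | ⟨f, hf⟩
    · rw [h0]; exact Set.countable_empty
    have hiso : ∀ g : Φ ⁻¹' {q}, ∃ e : @Language.Equiv L ℕ ℕ (S f) (S g), True := by
      rintro ⟨g, hg⟩
      have h1 : Φ f = Φ g := (hf : Φ f = q).trans (hg : Φ g = q).symm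
      exact ⟨Classical.choice (Quotient.exact h1), trivial⟩
    choose e _ using hiso
    let E : (Φ ⁻¹' {q}) → (ℕ ≃ ℕ) := fun g => @Language.Equiv.toEquiv L ℕ ℕ (S f) (S g) (e g)
    let j : (Φ ⁻¹' {q}) → ℕ × ℕ := fun g => ((E g).symm (t g), (E g).symm (t' g))
    have hj : Function.Injective j := by
      intro g g' h
      have ha : (E g).symm (t g) = (E g').symm (t g') := congrArg Prod.fst h
      have hb : (E g).symm (t' g) = (E g').symm (t' g') := congrArg Prod.snd h
      refine Subtype.ext (hrig g g' (@Language.Equiv.comp L ℕ ℕ (S g) (S f) ℕ (S g') (e g')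
        (@Language.Equiv.symm L ℕ ℕ (S f) (S g) (e g))) ?_ ?_)
      · show E g' ((E g).symm (t g)) = t g'
        rw [ha, Equiv.apply_symm_apply]
      · show E g' ((E g).symm (t' g)) = t' g'
        rw [hb, Equiv.apply_symm_apply]
    exact hj.countable
  have h1 := Cardinal.lift_mk_le_lift_mk_mul_of_lift_mk_preimage_le (c := ℵ₀) Φ (fun q => by
    have := (hfib q).le_aleph0
    exact Cardinal.lift_le_aleph0.2 this)
  have h2 : (2 : Cardinal.{max u v 1}) ^ ℵ₀ ≤ PaperDef.numCountableModels T * ℵ₀ := by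
    simpa [PaperDef.numCountableModels] using h1
  have h3 := h2.trans (Cardinal.mul_le_max_of_aleph0_le_right le_rfl)
  rcases le_max_iff.1 h3 with h4 | h4
  · exact h4
  · exact absurd h4 (not_le.2 (Cardinal.cantor _))

end
end DiscMod

namespace PaperDef
variable {L : FirstOrder.Language.{u, v}}
variable {M : Type w} [L.Structure M]

/-- Corollary 10. If `T` admits an infinite, relatively
∅-definable, discrete linear order on the locus of some complete type `p ∈ S₁(T)`,
then `T` has exactly `2 ^ ℵ₀` countably infinite models. -/
theorem statement17 (L : FirstOrder.Language.{u, v}) (hL : L.card ≤ ℵ₀)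
    (T : L.Theory) (hT : T.IsComplete)
    (M : Type w) [L.Structure M] (hMT : M ⊨ T) (hMinf : Infinite M)
    (hsat : IsAleph1Saturated L M)
    (p : Set (L.Formula (↥(∅ : Set M) ⊕ Fin 1)))
    (hcomp : IsCompleteType (∅ : Set M) p)
    (hpinf : (typeSet (∅ : Set M) p).Infinite)
    (φp : L.Formula (↥(∅ : Set M) ⊕ Fin 2))
    (rp : M → M → Prop)
    (hrp : rp = fun a b => a ∈ typeSet (∅ : Set M) p ∧ b ∈ typeSet (∅ : Set M) p ∧
      defRel (∅ : Set M) φp a b)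
    (hlin : IsLinearOn rp (typeSet (∅ : Set M) p))
    (hdisc : IsDiscreteOn rp (typeSet (∅ : Set M) p)) :
    numCountableModels T = 2 ^ ℵ₀ := by
  have heq : ∀ a ∈ typeSet (∅ : Set M) p, ∀ b ∈ typeSet (∅ : Set M) p,
      (rp a b ↔ defRel (∅ : Set M) φp a b) := by
    intro a ha b hb
    subst hrp
    exact ⟨fun h => h.2.2, fun h => ⟨ha, hb, h⟩⟩
  have dF : DiscMod.Dfn L (fun x : Fin 2 → M => defRel (∅ : Set M) φp (x 0) (x 1)) := by
    refine ⟨φp.relabel (Sum.elim (fun e => (e.2 : False).elim) id), fun y => ?_⟩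
    rw [Formula.realize_relabel]
    have : (y ∘ (Sum.elim (fun e => (e.2 : False).elim) id :
        ↥(∅ : Set M) ⊕ Fin 2 → Fin 2)) = pval ![y 0, y 1] := by
      funext i
      rcases i with i | i
      · exact (i.2 : False).elim
      · fin_cases i <;> rfl
    rw [this]
    rfl
  have hlin' : IsLinearOn (defRel (∅ : Set M) φp) (typeSet (∅ : Set M) p) := by
    obtain ⟨h1, h2, h3⟩ := hlin
    refine ⟨fun a ha h => h1 a ha ((heq a ha a ha).2 h), fun a ha b hb c hc hab hbc => ?_,
      fun a ha b hb => ?_⟩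
    · exact (heq a ha c hc).1 (h2 a ha b hb c hc ((heq a ha b hb).2 hab) ((heq b hb c hc).2 hbc))
    · rw [← heq a ha b hb, ← heq b hb a ha]
      exact h3 a ha b hb
  have hdisc' : IsDiscreteOn (defRel (∅ : Set M) φp) (typeSet (∅ : Set M) p) := by
    obtain ⟨h1, h2⟩ := hdisc
    refine ⟨fun a ha ⟨b, hb, hab⟩ => ?_, fun a ha ⟨b, hb, hab⟩ => ?_⟩
    · obtain ⟨s, hs, has, hc⟩ := h1 a ha ⟨b, hb, (heq a ha b hb).2 hab⟩
      refine ⟨s, hs, (heq a ha s hs).1 has, fun c hcP hac => ?_⟩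
      rw [← heq s hs c hcP]
      exact hc c hcP ((heq a ha c hcP).2 hac)
    · obtain ⟨s, hs, has, hc⟩ := h2 a ha ⟨b, hb, (heq b hb a ha).2 hab⟩
      refine ⟨s, hs, (heq s hs a ha).1 has, fun c hcP hac => ?_⟩
      rw [← heq c hcP s hs]
      exact hc c hcP ((heq c hcP a ha).2 hac)
  obtain ⟨θ, c, dθ, hθ, hc, hcF, hno⟩ := DiscMod.prep hsat p hcomp hpinf _ dF hlin' hdisc'
  obtain ⟨S, t, t', hS, hrig⟩ := DiscMod.descend hL _ dF θ c dθ hθ hc hcF hno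
  refine le_antisymm (DiscMod.upper hL T) (DiscMod.lower T S t t' (fun f => ?_) hrig)
  refine @Theory.Model.mk L ℕ (S f) T fun φ hφ => hS f φ (hMT.realize_of_mem φ hφ)

end PaperDef
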